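/- arXiv:1911.09111 — 2 statements merged into one kernel-verified Lean document; each statement's English description precedes it below -/
import Mathlib

section
/- Let (u, p) be a weak solution of the HHMO model. Then for every T > 0 the concentration u is Lipschitz continuous in space uniformly in time on ℝ × [T, ∞): there exists a constant L = L(T) such that |u(x₂, t) − u(x₁, t)| ≤ L·|x₂ − x₁| for all x₁, x₂ ∈ ℝ and all t ≥ T. -/
open MeasureTheory Filter Set

noncomputable section

/-- The precipitation-free self-similar solution `ψ(x,t)`. -/
def psi (α β x t : ℝ) : ℝ :=
  if 0 < t then
    (α * β / 2) * Real.exp (α ^ 2 / 4) *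
      ∫ ζ in Set.Ioi (max (|x| / Real.sqrt t) α), Real.exp (-ζ ^ 2 / 4)
  else 0

/-- The profile `Ψ(η)` in similarity coordinates. -/
def PsiP (α β η : ℝ) : ℝ :=
  (α * β / 2) * Real.exp (α ^ 2 / 4) * ∫ ζ in Set.Ioi (max η α), Real.exp (-ζ ^ 2 / 4)

/-- Regularity of a weak solution: `w` is the spatial derivative of `u - ψ`;
both are continuous on `ℝ × [0,∞)` and bounded on `ℝ × [0,T]` for every `T > 0`. -/
def AuxReg (α β : ℝ) (u w : ℝ → ℝ → ℝ) : Prop :=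
  (∀ t ∈ Set.Ici (0:ℝ), ∀ x : ℝ, HasDerivAt (fun y => u y t - psi α β y t) (w x t) x) ∧
  ContinuousOn (fun q : ℝ × ℝ => u q.1 q.2 - psi α β q.1 q.2) (Set.univ ×ˢ Set.Ici 0) ∧
  ContinuousOn (fun q : ℝ × ℝ => w q.1 q.2) (Set.univ ×ˢ Set.Ici 0) ∧
  ∀ T > (0:ℝ), ∃ C : ℝ, ∀ x : ℝ, ∀ t ∈ Set.Icc (0:ℝ) T,
    |u x t - psi α β x t| ≤ C ∧ |w x t| ≤ C

/-- A test function of class `C^{1,1}(ℝ × [0,T])`, vanishing for large `|x|` and at `t = T`,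
together with its partial derivatives `φt`, `φx`. -/
def IsTestFun (T : ℝ) (φ φt φx : ℝ → ℝ → ℝ) : Prop :=
  (∀ x : ℝ, ∀ t ∈ Set.Icc (0:ℝ) T,
    HasDerivWithinAt (fun s => φ x s) (φt x t) (Set.Icc 0 T) t) ∧
  (∀ x : ℝ, ∀ t ∈ Set.Icc (0:ℝ) T, HasDerivAt (fun y => φ y t) (φx x t) x) ∧
  ContinuousOn (fun q : ℝ × ℝ => φ q.1 q.2) (Set.univ ×ˢ Set.Icc 0 T) ∧
  ContinuousOn (fun q : ℝ × ℝ => φt q.1 q.2) (Set.univ ×ˢ Set.Icc 0 T) ∧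
  ContinuousOn (fun q : ℝ × ℝ => φx q.1 q.2) (Set.univ ×ˢ Set.Icc 0 T) ∧
  (∃ R : ℝ, ∀ x : ℝ, ∀ t ∈ Set.Icc (0:ℝ) T, R ≤ |x| → φ x t = 0) ∧
  (∀ x : ℝ, φ x T = 0)

/-- The weak form of the equation, relative to a given precipitation function `p` and
the spatial derivative `w` of `u - ψ`. -/
def WeakForm (α β : ℝ) (u p w : ℝ → ℝ → ℝ) : Prop :=
  ∀ T > (0:ℝ), ∀ φ φt φx : ℝ → ℝ → ℝ, IsTestFun T φ φt φx →
    (∫ t in Set.Ioc (0:ℝ) T, ∫ x : ℝ, φt x t * (u x t - psi α β x t))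
      = ∫ t in Set.Ioc (0:ℝ) T, ∫ x : ℝ, (φx x t * w x t + p x t * u x t * φ x t)

/-- A weak solution of the linear auxiliary problem with given precipitation function `p`. -/
def IsAuxSolution (α β : ℝ) (p u : ℝ → ℝ → ℝ) : Prop :=
  (∀ x t : ℝ, u (-x) t = u x t) ∧
  ∃ w : ℝ → ℝ → ℝ, AuxReg α β u w ∧ WeakForm α β u p w

/-- A weak solution `(u, p)` of the HHMO model. -/
def IsWeakSolution (α β ustar : ℝ) (u p : ℝ → ℝ → ℝ) : Prop :=
  (∀ x t : ℝ, u (-x) t = u x t) ∧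
  (∀ x t : ℝ, p (-x) t = p x t) ∧
  Measurable (fun q : ℝ × ℝ => p q.1 q.2) ∧
  (∀ x : ℝ, ∀ t ∈ Set.Ici (0:ℝ),
    (sSup ((fun s => u x s) '' Set.Icc 0 t) < ustar → p x t = 0) ∧
    (sSup ((fun s => u x s) '' Set.Icc 0 t) = ustar → p x t ∈ Set.Icc (0:ℝ) 1) ∧
    (ustar < sSup ((fun s => u x s) '' Set.Icc 0 t) → p x t = 1)) ∧
  (∀ x : ℝ, MonotoneOn (fun t => p x t) (Set.Ici (0:ℝ))) ∧
  ∃ w : ℝ → ℝ → ℝ, AuxReg α β u w ∧ WeakForm α β u p w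

/-- Condition (P): the precipitation function depends only on `x` beyond the parabola
`t = x²/α²`. -/
def CondP (α : ℝ) (p : ℝ → ℝ → ℝ) (pstar : ℝ → ℝ) : Prop :=
  Measurable pstar ∧
  ∀ᵐ x ∂(volume.restrict (Set.Ioi (0:ℝ))), ∀ t : ℝ, x ^ 2 / α ^ 2 < t → p x t = pstar x

/-- The admissible class `𝒜` of precipitation functions. -/
def IsAdmissible (p : ℝ → ℝ → ℝ) : Prop :=
  (∀ x t : ℝ, p (-x) t = p x t) ∧
  MeasureTheory.LocallyIntegrableOn (fun q : ℝ × ℝ => p q.1 q.2) (Set.Ioi 0 ×ˢ Set.Ici 0) ∧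
  ∀ T > (0:ℝ), ∃ R : ℝ, ∀ x ≥ R, ∀ t ∈ Set.Icc (0:ℝ) T, p x t = 0

/-- `u` converges uniformly, in parabolic similarity coordinates, to the profile `Φ`. -/
def ConvUnif (u : ℝ → ℝ → ℝ) (Φ : ℝ → ℝ) : Prop :=
  ∀ ε > (0:ℝ), ∃ T : ℝ, ∀ t ≥ T, ∀ η ≥ (0:ℝ), |u (η * Real.sqrt t) t - Φ η| < ε

/-- The error function. -/
def erf (x : ℝ) : ℝ := (2 / Real.sqrt Real.pi) * ∫ s in (0:ℝ)..x, Real.exp (-s ^ 2)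

/-- The complementary error function. -/
def erfc (x : ℝ) : ℝ := (2 / Real.sqrt Real.pi) * ∫ s in Set.Ioi x, Real.exp (-s ^ 2)

/-- Kummer's confluent hypergeometric function `M(a,b,z)` (real arguments). -/
def kummerM (a b z : ℝ) : ℝ :=
  ∑' n : ℕ, (Polynomial.eval a (ascPochhammer ℝ n) / Polynomial.eval b (ascPochhammer ℝ n))
    * z ^ n / (n.factorial : ℝ)

/-- `κ = (1 + √(4γ+1))/2`, the positive root of `κ(κ-1) = γ`. -/
def kappaOf (γ : ℝ) : ℝ := (1 + Real.sqrt (4 * γ + 1)) / 2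

/-- The value `u*_γ` determined by the derivative matching condition. -/
def ustarGamma (α β γ : ℝ) : ℝ :=
  (α * β / 2) *
    (kappaOf γ * kummerM (kappaOf γ / 2 + 1) (kappaOf γ + 1 / 2) (-α ^ 2 / 4) /
        (α * kummerM (kappaOf γ / 2) (kappaOf γ + 1 / 2) (-α ^ 2 / 4)) +
      Real.exp (-α ^ 2 / 4) / (Real.sqrt Real.pi * erfc (α / 2)))⁻¹

/-- The self-similar profile `Φ_γ`. -/
def Phi (α β γ η : ℝ) : ℝ :=
  if η < α then
    ustarGamma α β γ * η ^ kappaOf γ *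
      kummerM (kappaOf γ / 2) (kappaOf γ + 1 / 2) (-η ^ 2 / 4) /
      (α ^ kappaOf γ * kummerM (kappaOf γ / 2) (kappaOf γ + 1 / 2) (-α ^ 2 / 4))
  else ustarGamma α β γ * erfc (η / 2) / erfc (α / 2)

/-- The fundamental solution `exp (-r) * (4πr)^(-1/2) * exp (-z²/(4r))` of `∂ᵣ k = ∂ₓₓ k - k`. -/
def dampedKernel (r z : ℝ) : ℝ :=
  Real.exp (-r) * ((Real.sqrt (4 * Real.pi * r))⁻¹ * Real.exp (-z ^ 2 / (4 * r)))

lemma dampedKernel_nonneg (r z : ℝ) : 0 ≤ dampedKernel r z := by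
  unfold dampedKernel; positivity

lemma hasDerivAt_dampedKernel (r z : ℝ) :
    HasDerivAt (dampedKernel r) (-(z / (2 * r)) * dampedKernel r z) z := by
  have h : HasDerivAt (fun z : ℝ => -z ^ 2 / (4 * r)) (-(2 * z) / (4 * r)) z := by
    simpa using ((hasDerivAt_pow 2 z).neg).div_const (4 * r)
  have h' := ((h.exp).const_mul (Real.sqrt (4 * Real.pi * r))⁻¹).const_mul (Real.exp (-r))
  refine h'.congr_deriv ?_
  unfold dampedKernel
  rcases eq_or_ne r 0 with rfl | hr
  · simp
  · field_simp
    ring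

lemma hasDerivAt_dampedKernel_deriv (r z : ℝ) :
    HasDerivAt (fun z => -(z / (2 * r)) * dampedKernel r z)
      ((z ^ 2 / (4 * r ^ 2) - 1 / (2 * r)) * dampedKernel r z) z := by
  have h : HasDerivAt (fun z : ℝ => -(z / (2 * r))) (-(1 / (2 * r))) z :=
    ((hasDerivAt_id z).div_const (2 * r)).neg
  refine (h.mul (hasDerivAt_dampedKernel r z)).congr_deriv ?_
  rcases eq_or_ne r 0 with rfl | hr
  · simp
  · field_simp
    ring

lemma hasDerivAt_dampedKernel_left {r : ℝ} (hr : 0 < r) (z : ℝ) :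
    HasDerivAt (fun r => dampedKernel r z)
      ((z ^ 2 / (4 * r ^ 2) - 1 / (2 * r)) * dampedKernel r z - dampedKernel r z) r := by
  have hpos : 0 < 4 * Real.pi * r := by positivity
  have h1 : HasDerivAt (fun r : ℝ => Real.exp (-r)) (-Real.exp (-r)) r := by
    simpa using (hasDerivAt_neg r).exp
  have h2 : HasDerivAt (fun r : ℝ => (Real.sqrt (4 * Real.pi * r))⁻¹)
      (-(1 / (2 * r)) * (Real.sqrt (4 * Real.pi * r))⁻¹) r := by
    have h := ((((hasDerivAt_id r).const_mul (4 * Real.pi)).sqrt hpos.ne')).inv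
      (Real.sqrt_pos.2 hpos).ne'
    refine h.congr_deriv ?_
    have hs := Real.sq_sqrt hpos.le
    have hs0 := (Real.sqrt_pos.2 hpos).ne'
    simp only [id, mul_one]
    rw [hs]
    field_simp
  have h3 : HasDerivAt (fun r : ℝ => Real.exp (-z ^ 2 / (4 * r)))
      (Real.exp (-z ^ 2 / (4 * r)) * (z ^ 2 / (4 * r ^ 2))) r := by
    have h := (((hasDerivAt_id r).const_mul 4).inv (by simpa using hr.ne')).const_mul (-z ^ 2)
    have h' := h.exp
    simp only [id, ← div_eq_mul_inv, Pi.inv_apply] at h'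
    refine h'.congr_deriv ?_
    field_simp
  refine (h1.mul (h2.mul h3)).congr_deriv ?_
  simp only [Pi.mul_apply]
  unfold dampedKernel
  ring

lemma continuousOn_dampedKernel :
    ContinuousOn (fun q : ℝ × ℝ => dampedKernel q.1 q.2) (Ioi 0 ×ˢ univ) := by
  unfold dampedKernel
  intro q hq
  have hq : 0 < q.1 := hq.1
  have h : 0 < Real.sqrt (4 * Real.pi * q.1) := Real.sqrt_pos.2 (by positivity)
  apply ContinuousAt.continuousWithinAt
  fun_prop (disch := first | exact h.ne' | positivity)

lemma measurable_dampedKernel : Measurable (fun q : ℝ × ℝ => dampedKernel q.1 q.2) := by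
  unfold dampedKernel
  fun_prop

lemma exists_dampedKernel_le {ε R : ℝ} (hε : 0 < ε) (hR : ε ≤ R) :
    ∃ A : ℝ, 0 ≤ A ∧ ∀ r ∈ Icc ε R, ∀ z : ℝ,
      dampedKernel r z ≤ A * Real.exp (-(1 / (8 * R)) * z ^ 2) ∧
      |-(z / (2 * r)) * dampedKernel r z| ≤ A * Real.exp (-(1 / (8 * R)) * z ^ 2) ∧
      |(z ^ 2 / (4 * r ^ 2) - 1 / (2 * r)) * dampedKernel r z| ≤
        A * Real.exp (-(1 / (8 * R)) * z ^ 2) := by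
  have hR0 : 0 < R := hε.trans_le hR
  set s := (Real.sqrt (4 * Real.pi * ε))⁻¹ with hs
  have hs0 : 0 ≤ s := by positivity
  set B := 1 + 1 / ε + 1 / ε ^ 2 with hB
  set D := 1 + 8 * R with hD
  have key : ∀ r ∈ Icc ε R, ∀ z : ℝ, ∀ c : ℝ, |c| ≤ B * (1 + z ^ 2) →
      |c * dampedKernel r z| ≤ B * D * s * Real.exp (-(1 / (8 * R)) * z ^ 2) := by
    intro r hr z c hc
    have hr0 : 0 < r := hε.trans_le hr.1
    have h1 : dampedKernel r z ≤ s * Real.exp (-(1 / (4 * R)) * z ^ 2) := by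
      have e1 : Real.exp (-r) ≤ 1 := Real.exp_le_one_iff.2 (by linarith)
      have e2 : (Real.sqrt (4 * Real.pi * r))⁻¹ ≤ s := by
        apply inv_anti₀ (Real.sqrt_pos.2 (by positivity))
        apply Real.sqrt_le_sqrt
        have := hr.1
        gcongr
      have e3 : Real.exp (-z ^ 2 / (4 * r)) ≤ Real.exp (-(1 / (4 * R)) * z ^ 2) := by
        apply Real.exp_le_exp.2
        have : z ^ 2 / (4 * R) ≤ z ^ 2 / (4 * r) := by
          have := hr.2
          gcongr
        calc -z ^ 2 / (4 * r) = -(z ^ 2 / (4 * r)) := by ring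
          _ ≤ -(z ^ 2 / (4 * R)) := by linarith
          _ = _ := by ring
      unfold dampedKernel
      calc _ ≤ 1 * (s * Real.exp (-(1 / (4 * R)) * z ^ 2)) := by gcongr
        _ = _ := one_mul _
    have h2 : 1 + z ^ 2 ≤ D * Real.exp (1 / (8 * R) * z ^ 2) := by
      have h := Real.add_one_le_exp (1 / (8 * R) * z ^ 2)
      have h0 : 0 ≤ 1 / (8 * R) * z ^ 2 := by positivity
      have : z ^ 2 = 8 * R * (1 / (8 * R) * z ^ 2) := by field_simp
      calc 1 + z ^ 2 = 1 + 8 * R * (1 / (8 * R) * z ^ 2) := by rw [← this]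
        _ ≤ D * (1 / (8 * R) * z ^ 2 + 1) := by rw [hD]; nlinarith
        _ ≤ _ := by gcongr
    rw [abs_mul, abs_of_nonneg (dampedKernel_nonneg r z)]
    calc |c| * dampedKernel r z
        ≤ (B * (1 + z ^ 2)) * (s * Real.exp (-(1 / (4 * R)) * z ^ 2)) := by
          gcongr
          exact dampedKernel_nonneg r z
      _ ≤ (B * (D * Real.exp (1 / (8 * R) * z ^ 2))) * (s * Real.exp (-(1 / (4 * R)) * z ^ 2)) := by
          gcongr
      _ = B * D * s * (Real.exp (1 / (8 * R) * z ^ 2) * Real.exp (-(1 / (4 * R)) * z ^ 2)) := by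
          ring
      _ = _ := by
          rw [← Real.exp_add]
          congr 2
          field_simp
          ring
  refine ⟨B * D * s, by positivity, fun r hr z => ?_⟩
  have hr0 : 0 < r := hε.trans_le hr.1
  have hir : 1 / r ≤ 1 / ε := one_div_le_one_div_of_le hε hr.1
  have hir0 : 0 < 1 / r := by positivity
  have hir2 : 1 / r ^ 2 ≤ 1 / ε ^ 2 := by
    have := hr.1
    gcongr
  have hir20 : 0 < 1 / r ^ 2 := by positivity
  refine ⟨?_, key r hr z _ ?_, key r hr z _ ?_⟩
  · have := key r hr z 1 ?_
    · rwa [one_mul, abs_of_nonneg (dampedKernel_nonneg r z)] at this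
    · rw [abs_one, hB]
      have : 0 < 1 / ε := by positivity
      have : 0 < 1 / ε ^ 2 := by positivity
      nlinarith [sq_nonneg z]
  · have e : |-(z / (2 * r))| = |z| / 2 * (1 / r) := by
      rw [abs_neg, abs_div, abs_of_pos (by positivity : 0 < 2 * r)]
      field_simp
    rw [e]
    have hz : |z| / 2 ≤ 1 + z ^ 2 := by nlinarith [sq_abs z, sq_nonneg (|z| - 1)]
    calc |z| / 2 * (1 / r) ≤ (1 + z ^ 2) * (1 / ε) := by gcongr
      _ ≤ (1 + z ^ 2) * B := by
          gcongr
          rw [hB]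
          have : 0 < 1 / ε ^ 2 := by positivity
          linarith
      _ = _ := mul_comm _ _
  · have e : |z ^ 2 / (4 * r ^ 2) - 1 / (2 * r)| ≤ z ^ 2 / 4 * (1 / r ^ 2) + 1 / 2 * (1 / r) := by
      refine (abs_sub _ _).trans ?_
      rw [abs_of_nonneg (by positivity), abs_of_nonneg (by positivity)]
      apply le_of_eq
      field_simp
    refine e.trans ?_
    rw [hB]
    have h1 : z ^ 2 / 4 * (1 / r ^ 2) ≤ z ^ 2 * (1 / ε ^ 2) := by
      gcongr
      nlinarith [sq_nonneg z]
    have h2 : 0 < 1 / ε := by positivity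
    have h3 : 0 < 1 / ε ^ 2 := by positivity
    nlinarith [sq_nonneg z, mul_nonneg (sq_nonneg z) h2.le]

lemma integrable_dampedKernel {r : ℝ} (hr : 0 < r) : Integrable (dampedKernel r) := by
  have h := integrable_exp_neg_mul_sq (b := 1 / (4 * r)) (by positivity)
  refine ((h.const_mul (Real.sqrt (4 * Real.pi * r))⁻¹).const_mul (Real.exp (-r))).congr ?_
  filter_upwards with z
  unfold dampedKernel
  congr 3
  ring

lemma integral_dampedKernel {r : ℝ} (hr : 0 < r) : ∫ z, dampedKernel r z = Real.exp (-r) := by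
  have h := integral_gaussian (1 / (4 * r))
  have e : (fun z => Real.exp (-z ^ 2 / (4 * r))) = fun z => Real.exp (-(1 / (4 * r)) * z ^ 2) := by
    ext z; congr 1; ring
  unfold dampedKernel
  rw [integral_const_mul, integral_const_mul, e, h]
  have : Real.pi / (1 / (4 * r)) = 4 * Real.pi * r := by field_simp
  rw [this, inv_mul_cancel₀ (Real.sqrt_pos.2 (by positivity)).ne', mul_one]

lemma integrable_deriv_dampedKernel {r : ℝ} (hr : 0 < r) :
    Integrable (fun z => -(z / (2 * r)) * dampedKernel r z) := by
  have h := integrable_mul_exp_neg_mul_sq (b := 1 / (4 * r)) (by positivity)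
  refine (((h.const_mul (Real.sqrt (4 * Real.pi * r))⁻¹).const_mul (Real.exp (-r))).const_mul
    (-(1 / (2 * r)))).congr ?_
  filter_upwards with z
  unfold dampedKernel
  have : -(1 / (4 * r)) * z ^ 2 = -z ^ 2 / (4 * r) := by ring
  simp only [this]
  ring

lemma integral_abs_deriv_dampedKernel {r : ℝ} (hr : 0 < r) :
    ∫ z, |-(z / (2 * r)) * dampedKernel r z| = Real.exp (-r) * (Real.sqrt (Real.pi * r))⁻¹ := by
  have e : (fun z => |-(z / (2 * r)) * dampedKernel r z|) =
      fun z => (fun y => y / (2 * r) * dampedKernel r y) |z| := by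
    ext z
    rw [abs_mul, abs_neg, abs_div, abs_of_pos (by positivity : 0 < 2 * r),
      abs_of_nonneg (dampedKernel_nonneg r z)]
    simp [dampedKernel]
  rw [e, integral_comp_abs (f := fun y => y / (2 * r) * dampedKernel r y)]
  have h := integral_rpow_mul_exp_neg_mul_rpow (p := 2) (q := 1) (b := 1 / (4 * r))
    (by norm_num) (by norm_num) (by positivity)
  have e2 : ∫ y in Ioi (0:ℝ), y / (2 * r) * dampedKernel r y =
      ∫ y in Ioi (0:ℝ), (Real.exp (-r) * (Real.sqrt (4 * Real.pi * r))⁻¹ * (1 / (2 * r))) *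
        (y ^ (1:ℝ) * Real.exp (-(1 / (4 * r)) * y ^ (2:ℝ))) := by
    congr 1
    ext y
    unfold dampedKernel
    rw [Real.rpow_one, Real.rpow_two]
    have : -(1 / (4 * r)) * y ^ 2 = -y ^ 2 / (4 * r) := by ring
    rw [this]
    ring
  rw [e2, integral_const_mul, h]
  have e3 : Real.sqrt (4 * Real.pi * r) = 2 * Real.sqrt (Real.pi * r) := by
    rw [mul_assoc, Real.sqrt_mul (by norm_num), show (4:ℝ) = 2 ^ 2 by norm_num,
      Real.sqrt_sq (by norm_num)]
  have hs : Real.sqrt (Real.pi * r) ≠ 0 := (Real.sqrt_pos.2 (by positivity)).ne'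
  rw [e3]
  norm_num [Real.rpow_neg_one]
  field_simp
  norm_num

lemma integral_abs_sub_dampedKernel_le {r : ℝ} (hr : 0 < r) (a b : ℝ) :
    ∫ y, |dampedKernel r (y - b) - dampedKernel r (y - a)| ≤
      Real.exp (-r) * (Real.sqrt (Real.pi * r))⁻¹ * |b - a| := by
  wlog hab : a ≤ b generalizing a b
  · have := this b a (le_of_not_ge hab)
    simpa only [abs_sub_comm] using this
  set k' : ℝ → ℝ := fun z => -(z / (2 * r)) * dampedKernel r z with hk'
  have hk'c : Continuous k' := by
    have : Continuous (dampedKernel r) :=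
      continuous_iff_continuousAt.2 fun z => (hasDerivAt_dampedKernel r z).continuousAt
    fun_prop
  have hint : Integrable (fun q : ℝ × ℝ => |k' (q.1 - q.2)|)
      (volume.prod (volume.restrict (Ioc a b))) := by
    rw [integrable_prod_iff' (by fun_prop)]
    constructor
    · filter_upwards with θ
      exact ((integrable_deriv_dampedKernel hr).abs).comp_sub_right θ
    · have : ∀ θ, ∫ y, ‖|k' (y - θ)|‖ = ∫ y, |k' y| := fun θ => by
        simp only [Real.norm_eq_abs, abs_abs]
        exact integral_sub_right_eq_self (fun y => |k' y|) θ
      simp only [this]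
      exact integrable_const _
  have hpt : ∀ y, |dampedKernel r (y - b) - dampedKernel r (y - a)| ≤
      ∫ θ in Ioc a b, |k' (y - θ)| := by
    intro y
    have hd : ∀ θ ∈ uIcc a b, HasDerivAt (fun θ => dampedKernel r (y - θ)) (-k' (y - θ)) θ := by
      intro θ _
      have := (hasDerivAt_dampedKernel r (y - θ)).comp θ ((hasDerivAt_id θ).const_sub y)
      simpa [hk', Function.comp_def] using this
    rw [← intervalIntegral.integral_eq_sub_of_hasDerivAt hd
      ((by fun_prop : Continuous fun θ => -k' (y - θ)).intervalIntegrable _ _),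
      ← intervalIntegral.integral_of_le hab]
    refine (intervalIntegral.abs_integral_le_integral_abs hab).trans_eq ?_
    simp only [abs_neg]
  calc ∫ y, |dampedKernel r (y - b) - dampedKernel r (y - a)|
      ≤ ∫ y, ∫ θ in Ioc a b, |k' (y - θ)| := by
        apply integral_mono_of_nonneg (by filter_upwards with y using abs_nonneg _)
          hint.integral_prod_left
        filter_upwards with y using hpt y
    _ = ∫ θ in Ioc a b, ∫ y, |k' (y - θ)| := integral_integral_swap hint
    _ = ∫ θ in Ioc a b, ∫ y, |k' y| := by
        congr 1
        ext θ
        exact integral_sub_right_eq_self (fun y => |k' y|) θ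
    _ = _ := by
        rw [integral_abs_deriv_dampedKernel hr, setIntegral_const, abs_of_nonneg (by linarith)]
        simp [hab]
        ring

lemma tendsto_integral_integral_of_dominated {T : ℝ} {F : ℕ → ℝ → ℝ → ℝ} {G : ℝ → ℝ → ℝ}
    {b : ℝ → ℝ} (hb : Integrable b)
    (hF : ∀ n, AEStronglyMeasurable (fun q : ℝ × ℝ => F n q.1 q.2)
      ((volume.restrict (Ioc 0 T)).prod volume))
    (hFb : ∀ n, ∀ t ∈ Ioc 0 T, ∀ x, |F n t x| ≤ b x)
    (hlim : ∀ t ∈ Ioc 0 T, ∀ x, Tendsto (fun n => F n t x) atTop (nhds (G t x))) :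
    Tendsto (fun n => ∫ t in Ioc 0 T, ∫ x, F n t x) atTop
      (nhds (∫ t in Ioc 0 T, ∫ x, G t x)) := by
  set μ := (volume.restrict (Ioc 0 T)).prod (volume : Measure ℝ) with hμ
  have hmem : ∀ᵐ q ∂μ, q.1 ∈ Ioc 0 T := by
    have := ae_restrict_mem (μ := (volume : Measure ℝ)) (measurableSet_Ioc (a := (0:ℝ)) (b := T))
    exact Measure.quasiMeasurePreserving_fst.ae this
  have hbi : Integrable (fun q : ℝ × ℝ => b q.2) μ := hb.comp_snd _
  have hFb' : ∀ n, ∀ᵐ q ∂μ, ‖F n q.1 q.2‖ ≤ b q.2 := fun n => by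
    filter_upwards [hmem] with q hq using hFb n q.1 hq q.2
  have hlim' : ∀ᵐ q ∂μ, Tendsto (fun n => F n q.1 q.2) atTop (nhds (G q.1 q.2)) := by
    filter_upwards [hmem] with q hq using hlim q.1 hq q.2
  have hFi : ∀ n, Integrable (fun q : ℝ × ℝ => F n q.1 q.2) μ := fun n => hbi.mono' (hF n) (hFb' n)
  have hG : AEStronglyMeasurable (fun q : ℝ × ℝ => G q.1 q.2) μ :=
    aestronglyMeasurable_of_tendsto_ae atTop hF hlim'
  have hGi : Integrable (fun q : ℝ × ℝ => G q.1 q.2) μ := by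
    refine hbi.mono' hG ?_
    filter_upwards [hmem] with q hq
    exact le_of_tendsto (hlim q.1 hq q.2).norm
      (Eventually.of_forall fun n => hFb n q.1 hq q.2)
  have h := tendsto_integral_of_dominated_convergence _ hF hbi hFb' hlim'
  rw [integral_prod _ hGi] at h
  exact h.congr fun n => integral_prod _ (hFi n)

/-- Continuous bounded `v` with spatial derivative `w` solving `vₜ = vₓₓ - f` weakly on
`ℝ × [0,T]` with zero initial data. -/
structure IsBoundedHeatSolution (T C : ℝ) (v w f : ℝ → ℝ → ℝ) : Prop where
  continuous_v : Continuous (fun q : ℝ × ℝ => v q.1 q.2)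
  continuous_w : Continuous (fun q : ℝ × ℝ => w q.1 q.2)
  measurable_f : Measurable (fun q : ℝ × ℝ => f q.1 q.2)
  abs_v_le : ∀ x t, |v x t| ≤ C
  abs_w_le : ∀ x t, |w x t| ≤ C
  abs_f_le : ∀ x t, |f x t| ≤ C
  hasDerivAt : ∀ x t, HasDerivAt (fun y => v y t) (w x t) x
  weak : ∀ φ φt φx : ℝ → ℝ → ℝ, IsTestFun T φ φt φx →
    (∫ t in Ioc 0 T, ∫ x, φt x t * v x t) =
      ∫ t in Ioc 0 T, ∫ x, (φx x t * w x t + f x t * φ x t)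

lemma ContinuousOn.aestronglyMeasurable_swap_strip {T : ℝ} {f : ℝ → ℝ → ℝ}
    (hf : ContinuousOn (fun q : ℝ × ℝ => f q.1 q.2) (univ ×ˢ Icc 0 T)) :
    AEStronglyMeasurable (fun q : ℝ × ℝ => f q.2 q.1)
      ((volume.restrict (Ioc 0 T)).prod volume) := by
  have h : ContinuousOn (fun q : ℝ × ℝ => f q.2 q.1) (Ioc 0 T ×ˢ univ) :=
    hf.comp continuous_swap.continuousOn fun q hq => ⟨trivial, Ioc_subset_Icc_self hq.1⟩
  have := h.aestronglyMeasurable (μ := volume) (measurableSet_Ioc.prod MeasurableSet.univ)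
  rwa [Measure.volume_eq_prod, ← Measure.prod_restrict, Measure.restrict_univ] at this

/-- The weak form extends to test functions dominated by an integrable function of `x`. -/
lemma IsBoundedHeatSolution.weak_of_dominated {T C : ℝ} {v w f : ℝ → ℝ → ℝ}
    (h : IsBoundedHeatSolution T C v w f) {H Ht Hx : ℝ → ℝ → ℝ} {b : ℝ → ℝ} (hb : Integrable b)
    (hHt : ∀ x, ∀ t ∈ Icc 0 T, HasDerivWithinAt (fun s => H x s) (Ht x t) (Icc 0 T) t)
    (hHx : ∀ x, ∀ t ∈ Icc 0 T, HasDerivAt (fun y => H y t) (Hx x t) x)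
    (hHc : ContinuousOn (fun q : ℝ × ℝ => H q.1 q.2) (univ ×ˢ Icc 0 T))
    (hHtc : ContinuousOn (fun q : ℝ × ℝ => Ht q.1 q.2) (univ ×ˢ Icc 0 T))
    (hHxc : ContinuousOn (fun q : ℝ × ℝ => Hx q.1 q.2) (univ ×ˢ Icc 0 T))
    (hHb : ∀ x, ∀ t ∈ Icc 0 T, |H x t| ≤ b x ∧ |Ht x t| ≤ b x ∧ |Hx x t| ≤ b x)
    (hHT : ∀ x, H x T = 0) :
    (∫ t in Ioc 0 T, ∫ x, Ht x t * v x t) =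
      ∫ t in Ioc 0 T, ∫ x, (Hx x t * w x t + f x t * H x t) := by
  have hC : 0 ≤ C := (abs_nonneg _).trans (h.abs_v_le 0 0)
  let χ : ContDiffBump (0:ℝ) := ⟨1, 2, one_pos, one_lt_two⟩
  have hχd : Differentiable ℝ χ := (χ.contDiff (n := 1)).differentiable one_ne_zero
  have hχ'c : Continuous (deriv χ) := (χ.contDiff (n := 1)).continuous_deriv le_rfl
  obtain ⟨B, hB⟩ := (χ.hasCompactSupport.deriv).exists_bound_of_continuous hχ'c
  have hB0 : 0 ≤ B := (norm_nonneg _).trans (hB 0)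
  set c : ℕ → ℝ := fun n => 1 / ((n:ℝ) + 1) with hc
  have hc0 : ∀ n, 0 < c n := fun n => by simp only [hc]; positivity
  have hc1 : ∀ n, c n ≤ 1 := fun n => by
    simp only [hc]
    rw [div_le_one (by positivity)]
    linarith [(Nat.cast_nonneg n : (0:ℝ) ≤ n)]
  have hclim : Tendsto c atTop (nhds 0) := tendsto_one_div_add_atTop_nhds_zero_nat
  have hχ1 : ∀ y, |χ y| ≤ 1 := fun y => by
    rw [abs_of_nonneg χ.nonneg]; exact χ.le_one
  have hχlim : ∀ x : ℝ, Tendsto (fun n => χ (c n * x)) atTop (nhds 1) := fun x => by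
    have h1 : Tendsto (fun n => c n * x) atTop (nhds (0 * x)) := hclim.mul_const x
    rw [zero_mul] at h1
    have h2 := (χ.continuous.tendsto 0).comp h1
    rwa [χ.one_of_mem_closedBall (by simp [χ.rIn_pos.le])] at h2
  have hχ'lim : ∀ x : ℝ, Tendsto (fun n => c n * deriv χ (c n * x)) atTop (nhds 0) := fun x => by
    refine squeeze_zero_norm (a := fun n => c n * B) (fun n => ?_) (by simpa using hclim.mul_const B)
    rw [norm_mul, Real.norm_of_nonneg (hc0 n).le]
    exact mul_le_mul_of_nonneg_left (hB _) (hc0 n).le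
  have hχ'b : ∀ n x, |c n * deriv χ (c n * x)| ≤ B := fun n x => by
    rw [abs_mul, abs_of_nonneg (hc0 n).le]
    calc _ ≤ 1 * B := mul_le_mul (hc1 n) (hB _) (abs_nonneg _) zero_le_one
      _ = B := one_mul B
  have htest : ∀ n, IsTestFun T (fun x t => χ (c n * x) * H x t) (fun x t => χ (c n * x) * Ht x t)
      (fun x t => c n * deriv χ (c n * x) * H x t + χ (c n * x) * Hx x t) := by
    intro n
    have hχc : Continuous (fun q : ℝ × ℝ => χ (c n * q.1)) :=
      χ.continuous.comp (by fun_prop)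
    have hχ'c' : Continuous (fun q : ℝ × ℝ => c n * deriv χ (c n * q.1)) :=
      continuous_const.mul (hχ'c.comp (by fun_prop))
    refine ⟨fun x t ht => (hHt x t ht).const_mul _, fun x t ht => ?_, hχc.continuousOn.mul hHc,
      hχc.continuousOn.mul hHtc, (hχ'c'.continuousOn.mul hHc).add (hχc.continuousOn.mul hHxc),
      ⟨2 / c n, fun x t _ hx => ?_⟩, fun x => by simp [hHT x]⟩
    · have h1 : HasDerivAt (fun y => χ (c n * y)) (c n * deriv χ (c n * x)) x := by
        have := (hχd (c n * x)).hasDerivAt.comp x ((hasDerivAt_id x).const_mul (c n))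
        simpa [Function.comp_def, mul_comm] using this
      exact h1.mul (hHx x t ht)
    · have : χ (c n * x) = 0 := by
        apply χ.zero_of_le_dist
        rw [dist_zero_right, Real.norm_eq_abs, abs_mul, abs_of_pos (hc0 n)]
        rwa [div_le_iff₀' (hc0 n)] at hx
      simp [this]
  have hχm : ∀ n, AEStronglyMeasurable (fun q : ℝ × ℝ => χ (c n * q.2))
      ((volume.restrict (Ioc 0 T)).prod volume) := fun n =>
    (χ.continuous.comp (by fun_prop : Continuous fun q : ℝ × ℝ => c n * q.2)).aestronglyMeasurable
  have hχ'm : ∀ n, AEStronglyMeasurable (fun q : ℝ × ℝ => c n * deriv χ (c n * q.2))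
      ((volume.restrict (Ioc 0 T)).prod volume) := fun n =>
    (continuous_const.mul (hχ'c.comp
      (by fun_prop : Continuous fun q : ℝ × ℝ => c n * q.2))).aestronglyMeasurable
  have hfm : AEStronglyMeasurable (fun q : ℝ × ℝ => f q.2 q.1)
      ((volume.restrict (Ioc 0 T)).prod volume) :=
    (h.measurable_f.comp measurable_swap).aestronglyMeasurable
  have hvm := h.continuous_v.continuousOn.aestronglyMeasurable_swap_strip (T := T)
  have hwm := h.continuous_w.continuousOn.aestronglyMeasurable_swap_strip (T := T)
  have hHm := hHc.aestronglyMeasurable_swap_strip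
  have hHtm := hHtc.aestronglyMeasurable_swap_strip
  have hHxm := hHxc.aestronglyMeasurable_swap_strip
  have hL : Tendsto (fun n => ∫ t in Ioc 0 T, ∫ x, χ (c n * x) * Ht x t * v x t) atTop
      (nhds (∫ t in Ioc 0 T, ∫ x, Ht x t * v x t)) := by
    refine tendsto_integral_integral_of_dominated
      (F := fun n t x => χ (c n * x) * Ht x t * v x t) (hb.const_mul C)
      (fun n => ((hχm n).mul hHtm).mul hvm) (fun n t ht x => ?_) (fun t _ x => ?_)
    · rw [abs_mul, abs_mul, mul_comm C]
      have h2 := (hHb x t (Ioc_subset_Icc_self ht)).2.1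
      have hb0 : 0 ≤ b x := (abs_nonneg _).trans h2
      calc _ ≤ 1 * b x * C := by
            gcongr
            · exact hχ1 _
            · exact h.abs_v_le x t
        _ = _ := by ring
    · simpa using ((hχlim x).mul_const (Ht x t)).mul_const (v x t)
  have hR : Tendsto (fun n => ∫ t in Ioc 0 T, ∫ x,
      ((c n * deriv χ (c n * x) * H x t + χ (c n * x) * Hx x t) * w x t
        + f x t * (χ (c n * x) * H x t))) atTop
      (nhds (∫ t in Ioc 0 T, ∫ x, (Hx x t * w x t + f x t * H x t))) := by
    refine tendsto_integral_integral_of_dominated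
      (F := fun n t x => (c n * deriv χ (c n * x) * H x t + χ (c n * x) * Hx x t) * w x t
        + f x t * (χ (c n * x) * H x t)) (hb.const_mul ((B + 2) * C))
      (fun n => ((((hχ'm n).mul hHm).add ((hχm n).mul hHxm)).mul hwm).add
        (hfm.mul ((hχm n).mul hHm))) (fun n t ht x => ?_) (fun t _ x => ?_)
    · obtain ⟨h1, -, h3⟩ := hHb x t (Ioc_subset_Icc_self ht)
      have hb0 : 0 ≤ b x := (abs_nonneg _).trans h1
      refine (abs_add_le _ _).trans ?_
      rw [abs_mul, abs_mul (f x t), abs_mul (χ _)]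
      have e1 : |c n * deriv χ (c n * x) * H x t + χ (c n * x) * Hx x t| ≤ B * b x + 1 * b x := by
        refine (abs_add_le _ _).trans ?_
        rw [abs_mul, abs_mul (χ _)]
        gcongr
        · exact hχ'b n x
        · exact hχ1 _
      calc _ ≤ (B * b x + 1 * b x) * C + C * (1 * b x) := by
            gcongr
            · exact h.abs_w_le x t
            · exact h.abs_f_le x t
            · exact hχ1 _
        _ = _ := by ring
    · have := ((((hχ'lim x).mul_const (H x t)).add ((hχlim x).mul_const (Hx x t))).mul_const
        (w x t)).add (((hχlim x).mul_const (H x t)).const_mul (f x t))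
      simpa using this
  refine tendsto_nhds_unique hL (hR.congr fun n => ?_)
  exact (h.weak _ _ _ (htest n)).symm

lemma integrable_section_and_integral_of_dominated {T : ℝ} {F : ℝ → ℝ → ℝ} {b : ℝ → ℝ}
    (hb : Integrable b) (hF : Measurable (fun q : ℝ × ℝ => F q.1 q.2))
    (hFb : ∀ t ∈ Ioc 0 T, ∀ x, |F t x| ≤ b x) :
    (∀ t ∈ Ioc 0 T, Integrable (F t)) ∧ IntegrableOn (fun t => ∫ x, F t x) (Ioc 0 T) := by
  refine ⟨fun t ht => hb.mono' (hF.comp measurable_prodMk_left).aestronglyMeasurable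
    (Eventually.of_forall (hFb t ht)), ?_⟩
  have hi : Integrable (fun q : ℝ × ℝ => F q.1 q.2) ((volume.restrict (Ioc 0 T)).prod volume) := by
    refine (hb.comp_snd _).mono' hF.aestronglyMeasurable ?_
    have := ae_restrict_mem (μ := (volume : Measure ℝ)) (measurableSet_Ioc (a := (0:ℝ)) (b := T))
    filter_upwards [Measure.quasiMeasurePreserving_fst.ae this] with q hq using hFb q.1 hq q.2
  exact hi.integral_prod_left

/-- Duhamel's formula against the damped kernel, averaged in time with weight `θ`. -/
lemma IsBoundedHeatSolution.integral_mul_average {T C ε : ℝ} {v w f : ℝ → ℝ → ℝ}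
    (h : IsBoundedHeatSolution T C v w f) (hε : 0 < ε) (x : ℝ) {θ : ℝ → ℝ}
    (hθ : Continuous θ) :
    IntegrableOn (fun s => (∫ σ in s..T, θ σ) *
        ∫ y, dampedKernel (T + ε - s) (y - x) * (v y s - f y s)) (Ioc 0 T) ∧
    ∫ s in Ioc 0 T, θ s * ∫ y, dampedKernel (T + ε - s) (y - x) * v y s =
      ∫ s in Ioc 0 T, (∫ σ in s..T, θ σ) *
        ∫ y, dampedKernel (T + ε - s) (y - x) * (v y s - f y s) := by
  rcases le_or_gt T 0 with hT | hT
  · simp [Ioc_eq_empty hT.not_gt]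
  have hC : 0 ≤ C := (abs_nonneg _).trans (h.abs_v_le 0 0)
  set η : ℝ → ℝ := fun s => ∫ σ in s..T, θ σ with hη
  have hηd : ∀ s, HasDerivAt η (-θ s) s := fun s =>
    intervalIntegral.integral_hasDerivAt_left (hθ.intervalIntegrable _ _)
      (hθ.stronglyMeasurableAtFilter _ _) hθ.continuousAt
  have hηc : Continuous η := continuous_iff_continuousAt.2 fun s => (hηd s).continuousAt
  obtain ⟨A, hA0, hA⟩ := exists_dampedKernel_le hε (by linarith : ε ≤ T + ε)
  set c : ℝ := 1 / (8 * (T + ε)) with hc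
  have hc0 : 0 < c := by rw [hc]; positivity
  have hr : ∀ s ∈ Icc 0 T, T + ε - s ∈ Icc ε (T + ε) := fun s hs =>
    ⟨by linarith [hs.2], by linarith [hs.1]⟩
  have hrpos : ∀ s ∈ Icc 0 T, 0 < T + ε - s := fun s hs => hε.trans_le (hr s hs).1
  have hE : Integrable (fun y => Real.exp (-c * (y - x) ^ 2)) :=
    (integrable_exp_neg_mul_sq hc0).comp_sub_right x
  obtain ⟨M, hM⟩ := (isCompact_Icc (a := (0:ℝ)) (b := T)).exists_bound_of_continuousOn
    (f := fun s => |η s| + |θ s|) (by fun_prop)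
  have hM' : ∀ s ∈ Icc 0 T, |η s| ≤ M ∧ |θ s| ≤ M := fun s hs => by
    have := (le_abs_self _).trans (hM s hs)
    constructor <;> linarith [abs_nonneg (η s), abs_nonneg (θ s)]
  have hM0 : 0 ≤ M := (norm_nonneg _).trans (hM 0 ⟨le_rfl, hT.le⟩)
  set K : ℝ → ℝ → ℝ := fun y s => dampedKernel (T + ε - s) (y - x) with hK
  set K1 : ℝ → ℝ → ℝ := fun y s => -((y - x) / (2 * (T + ε - s))) * K y s with hK1
  set K2 : ℝ → ℝ → ℝ := fun y s =>
    ((y - x) ^ 2 / (4 * (T + ε - s) ^ 2) - 1 / (2 * (T + ε - s))) * K y s with hK2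
  have hKb : ∀ y, ∀ s ∈ Icc 0 T, |K y s| ≤ A * Real.exp (-c * (y - x) ^ 2) := fun y s hs => by
    rw [abs_of_nonneg (dampedKernel_nonneg _ _)]
    exact (hA _ (hr s hs) (y - x)).1
  have hK1b : ∀ y, ∀ s ∈ Icc 0 T, |K1 y s| ≤ A * Real.exp (-c * (y - x) ^ 2) := fun y s hs =>
    (hA _ (hr s hs) (y - x)).2.1
  have hK2b : ∀ y, ∀ s ∈ Icc 0 T, |K2 y s| ≤ A * Real.exp (-c * (y - x) ^ 2) := fun y s hs =>
    (hA _ (hr s hs) (y - x)).2.2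
  have hKd : ∀ y s, HasDerivAt (fun y => K y s) (K1 y s) y := fun y s =>
    (hasDerivAt_dampedKernel (T + ε - s) (y - x)).comp_sub_const y x
  have hK1d : ∀ y s, HasDerivAt (fun y => K1 y s) (K2 y s) y := fun y s =>
    (hasDerivAt_dampedKernel_deriv (T + ε - s) (y - x)).comp_sub_const y x
  have hKt : ∀ y, ∀ s ∈ Icc 0 T, HasDerivAt (fun s => K y s) (-(K2 y s - K y s)) s :=
    fun y s hs => (hasDerivAt_dampedKernel_left (hrpos s hs) (y - x)).comp_const_sub (T + ε) s
  have hKc : ContinuousOn (fun q : ℝ × ℝ => K q.1 q.2) (univ ×ˢ Icc 0 T) :=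
    continuousOn_dampedKernel.comp (f := fun q : ℝ × ℝ => (T + ε - q.2, q.1 - x)) (by fun_prop)
      fun q hq => ⟨hrpos _ hq.2, trivial⟩
  have hne : ∀ q ∈ (univ : Set ℝ) ×ˢ Icc 0 T, T + ε - q.2 ≠ 0 := fun q hq => (hrpos _ hq.2).ne'
  have hK1c : ContinuousOn (fun q : ℝ × ℝ => K1 q.1 q.2) (univ ×ˢ Icc 0 T) := by
    refine ContinuousOn.mul (ContinuousOn.neg (ContinuousOn.div (by fun_prop) (by fun_prop) ?_)) hKc
    intro q hq
    exact mul_ne_zero two_ne_zero (hne q hq)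
  have hK2c : ContinuousOn (fun q : ℝ × ℝ => K2 q.1 q.2) (univ ×ˢ Icc 0 T) := by
    refine ContinuousOn.mul (ContinuousOn.sub (ContinuousOn.div (by fun_prop) (by fun_prop) ?_)
      (ContinuousOn.div (by fun_prop) (by fun_prop) ?_)) hKc
    · intro q hq
      exact mul_ne_zero four_ne_zero (pow_ne_zero _ (hne q hq))
    · intro q hq
      exact mul_ne_zero two_ne_zero (hne q hq)
  have hηc2 : ContinuousOn (fun q : ℝ × ℝ => η q.2) (univ ×ˢ Icc 0 T) := by fun_prop
  have hθc2 : ContinuousOn (fun q : ℝ × ℝ => θ q.2) (univ ×ˢ Icc 0 T) := by fun_prop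
  have hweak := h.weak_of_dominated (H := fun y s => η s * K y s)
    (Ht := fun y s => -θ s * K y s + η s * -(K2 y s - K y s)) (Hx := fun y s => η s * K1 y s)
    (hE.const_mul (3 * M * A))
    (fun y s hs => ((hηd s).mul (hKt y s hs)).hasDerivWithinAt)
    (fun y s hs => (hKd y s).const_mul (η s))
    (hηc2.mul hKc) ((hθc2.neg.mul hKc).add (hηc2.mul (hK2c.sub hKc).neg)) (hηc2.mul hK1c)
    (fun y s hs => by
      obtain ⟨hm1, hm2⟩ := hM' s hs
      have k0 := hKb y s hs
      have k1 := hK1b y s hs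
      have k2 := hK2b y s hs
      have e0 : 0 ≤ A * Real.exp (-c * (y - x) ^ 2) := by positivity
      set E := A * Real.exp (-c * (y - x) ^ 2)
      have hME : 3 * M * A * Real.exp (-c * (y - x) ^ 2) = 3 * (M * E) := by ring
      have hME0 : 0 ≤ M * E := by positivity
      rw [hME]
      refine ⟨?_, ?_, ?_⟩
      · rw [abs_mul]
        have := mul_le_mul hm1 k0 (abs_nonneg _) hM0
        linarith
      · refine (abs_add_le _ _).trans ?_
        rw [abs_mul, abs_mul, abs_neg, abs_neg]
        have a1 := mul_le_mul hm2 k0 (abs_nonneg _) hM0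
        have a2 := mul_le_mul hm1 ((abs_sub _ _).trans (add_le_add k2 k0)) (abs_nonneg _) hM0
        linarith
      · rw [abs_mul]
        have := mul_le_mul hm1 k1 (abs_nonneg _) hM0
        linarith)
    (fun y => by simp [hη])
  have hKm : Measurable (fun q : ℝ × ℝ => K q.2 q.1) :=
    measurable_dampedKernel.comp (f := fun q : ℝ × ℝ => (T + ε - q.1, q.2 - x)) (by fun_prop)
  have hK1m : Measurable (fun q : ℝ × ℝ => K1 q.2 q.1) := by
    refine Measurable.mul ?_ hKm
    fun_prop
  have hK2m : Measurable (fun q : ℝ × ℝ => K2 q.2 q.1) := by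
    refine Measurable.mul ?_ hKm
    fun_prop
  have hvm : Measurable (fun q : ℝ × ℝ => v q.2 q.1) := h.continuous_v.measurable.comp measurable_swap
  have hwm : Measurable (fun q : ℝ × ℝ => w q.2 q.1) := h.continuous_w.measurable.comp measurable_swap
  have hfm : Measurable (fun q : ℝ × ℝ => f q.2 q.1) := h.measurable_f.comp measurable_swap
  have hint : ∀ k g : ℝ → ℝ → ℝ, Measurable (fun q : ℝ × ℝ => k q.2 q.1) →
      Measurable (fun q : ℝ × ℝ => g q.2 q.1) →
      (∀ y, ∀ s ∈ Icc 0 T, |k y s| ≤ A * Real.exp (-c * (y - x) ^ 2)) →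
      (∀ y s, |g y s| ≤ C) →
      (∀ s ∈ Ioc 0 T, Integrable (fun y => k y s * g y s)) ∧
        IntegrableOn (fun s => ∫ y, k y s * g y s) (Ioc 0 T) := by
    intro k g hkm hgm hk hg
    refine integrable_section_and_integral_of_dominated (F := fun s y => k y s * g y s)
      (hE.const_mul (A * C)) (hkm.mul hgm) fun s hs y => ?_
    rw [abs_mul]
    calc _ ≤ (A * Real.exp (-c * (y - x) ^ 2)) * C := by
          gcongr
          · exact hk y s (Ioc_subset_Icc_self hs)
          · exact hg y s
      _ = _ := by ring
  obtain ⟨i1, I1⟩ := hint K v hKm hvm hKb h.abs_v_le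
  obtain ⟨i2, I2⟩ := hint K2 v hK2m hvm hK2b h.abs_v_le
  obtain ⟨i3, I3⟩ := hint K f hKm hfm hKb h.abs_f_le
  obtain ⟨i4, -⟩ := hint K1 w hK1m hwm hK1b h.abs_w_le
  obtain ⟨i5, -⟩ := hint K1 v hK1m hvm hK1b h.abs_v_le
  have hmulI : ∀ g J : ℝ → ℝ, Continuous g → IntegrableOn J (Ioc 0 T) →
      IntegrableOn (fun s => g s * J s) (Ioc 0 T) := by
    intro g J hg hJ
    rw [← integrableOn_Icc_iff_integrableOn_Ioc] at hJ ⊢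
    exact hJ.continuousOn_mul hg.continuousOn isCompact_Icc
  set S1 : ℝ → ℝ := fun s => ∫ y, K y s * v y s with hS1
  set S2 : ℝ → ℝ := fun s => ∫ y, K2 y s * v y s with hS2
  set S3 : ℝ → ℝ := fun s => ∫ y, K y s * f y s with hS3
  have hparts : ∀ s ∈ Ioc 0 T, ∫ y, K1 y s * w y s = -S2 s := fun s hs =>
    integral_mul_deriv_eq_deriv_mul_of_integrable (u := fun y => K1 y s) (v := fun y => v y s)
      (fun y _ => hK1d y s) (fun y _ => h.hasDerivAt y s) (i4 s hs) (i2 s hs) (i5 s hs)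
  have hLHS : ∀ s ∈ Ioc 0 T, (∫ y, (-θ s * K y s + η s * -(K2 y s - K y s)) * v y s) =
      -(θ s * S1 s) - η s * S2 s + η s * S1 s := fun s hs => by
    have e : (fun y => (-θ s * K y s + η s * -(K2 y s - K y s)) * v y s) = fun y =>
        (η s - θ s) * (K y s * v y s) - η s * (K2 y s * v y s) := by
      ext y; ring
    rw [e, integral_sub ((i1 s hs).const_mul _) ((i2 s hs).const_mul _), integral_const_mul,
      integral_const_mul]
    ring
  have hRHS : ∀ s ∈ Ioc 0 T, (∫ y, (η s * K1 y s * w y s + f y s * (η s * K y s))) =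
      -(η s * S2 s) + η s * S3 s := fun s hs => by
    have e : (fun y => η s * K1 y s * w y s + f y s * (η s * K y s)) = fun y =>
        η s * (K1 y s * w y s) + η s * (K y s * f y s) := by
      ext y; ring
    rw [e, integral_add ((i4 s hs).const_mul _) ((i3 s hs).const_mul _), integral_const_mul,
      integral_const_mul, hparts s hs]
    ring
  have hdiff : ∀ s ∈ Ioc 0 T, η s * ∫ y, K y s * (v y s - f y s) = η s * S1 s - η s * S3 s :=
    fun s hs => by
      have e : (fun y => K y s * (v y s - f y s)) = fun y => K y s * v y s - K y s * f y s := by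
        ext y; ring
      rw [e, integral_sub (i1 s hs) (i3 s hs)]
      ring
  have J1 := hmulI θ S1 hθ I1
  have J2 := hmulI η S1 hηc I1
  have J3 := hmulI η S2 hηc I2
  have J4 := hmulI η S3 hηc I3
  refine ⟨(integrableOn_congr_fun hdiff measurableSet_Ioc).2 (J2.sub J4), ?_⟩
  rw [setIntegral_congr_fun measurableSet_Ioc hLHS, setIntegral_congr_fun measurableSet_Ioc hRHS]
    at hweak
  rw [setIntegral_congr_fun measurableSet_Ioc hdiff, integral_sub J2 J4]
  rw [integral_add (f := fun s => -(θ s * S1 s) - η s * S2 s) (J1.neg.sub J3) J2,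
    integral_sub (f := fun s => -(θ s * S1 s)) J1.neg J3, integral_neg,
    integral_add (f := fun s => -(η s * S2 s)) J3.neg J4, integral_neg] at hweak
  linarith

lemma dampedKernel_eq_scaled {r : ℝ} (hr : 0 < r) (z : ℝ) :
    dampedKernel r (Real.sqrt r * z) = (Real.sqrt r)⁻¹ * (Real.exp (1 - r) * dampedKernel 1 z) := by
  have h1 : Real.sqrt (4 * Real.pi * r) = Real.sqrt (4 * Real.pi) * Real.sqrt r :=
    Real.sqrt_mul (by positivity) r
  have h2 : -(Real.sqrt r * z) ^ 2 / (4 * r) = -z ^ 2 / 4 := by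
    rw [mul_pow, Real.sq_sqrt hr.le]
    field_simp
  have h3 : Real.exp (1 - r) * Real.exp (-1) = Real.exp (-r) := by
    rw [← Real.exp_add]
    congr 1
    ring
  unfold dampedKernel
  rw [h1, h2, ← h3, mul_one, mul_one, mul_inv]
  ring

/-- The damped heat semigroup at time `r` applied to `v (·, s)`, continuous up to `r = 0`. -/
def dampedAverage (v : ℝ → ℝ → ℝ) (x r s : ℝ) : ℝ :=
  Real.exp (1 - r) * ∫ z, dampedKernel 1 z * v (x + Real.sqrt r * z) s

lemma integral_dampedKernel_mul {r : ℝ} (hr : 0 < r) (v : ℝ → ℝ → ℝ) (x s : ℝ) :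
    ∫ y, dampedKernel r (y - x) * v y s = dampedAverage v x r s := by
  have hs : 0 < Real.sqrt r := Real.sqrt_pos.2 hr
  have h1 : ∫ y, dampedKernel r (y - x) * v y s = ∫ z, dampedKernel r z * v (x + z) s := by
    rw [← integral_sub_right_eq_self (fun z => dampedKernel r z * v (x + z) s) x]
    simp
  have h2 := Measure.integral_comp_mul_left (fun z => dampedKernel r z * v (x + z) s) (Real.sqrt r)
  rw [abs_of_pos (inv_pos.2 hs), smul_eq_mul, eq_inv_mul_iff_mul_eq₀ hs.ne'] at h2
  rw [h1, ← h2, dampedAverage, ← integral_const_mul, ← integral_const_mul]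
  congr 1
  ext z
  rw [dampedKernel_eq_scaled hr]
  field_simp

lemma dampedAverage_zero (v : ℝ → ℝ → ℝ) (x s : ℝ) : dampedAverage v x 0 s = v x s := by
  simp only [dampedAverage, Real.sqrt_zero, zero_mul, add_zero, integral_mul_const,
    integral_dampedKernel one_pos]
  rw [← mul_assoc, ← Real.exp_add]
  simp

lemma continuous_dampedAverage {v : ℝ → ℝ → ℝ} {C : ℝ}
    (hv : Continuous (fun q : ℝ × ℝ => v q.1 q.2)) (hC : ∀ x t, |v x t| ≤ C) (x : ℝ) :
    Continuous (fun q : ℝ × ℝ => dampedAverage v x q.1 q.2) := by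
  have hk : Continuous (dampedKernel 1) :=
    continuous_iff_continuousAt.2 fun z => (hasDerivAt_dampedKernel 1 z).continuousAt
  refine Continuous.mul (by fun_prop) (continuous_of_dominated
    (bound := fun z => dampedKernel 1 z * C) (fun q => ?_) (fun q => ?_)
    ((integrable_dampedKernel one_pos).mul_const C) ?_)
  · exact (hk.mul (hv.comp (f := fun z => (x + Real.sqrt q.1 * z, q.2))
      (by fun_prop))).aestronglyMeasurable
  · filter_upwards with z
    rw [norm_mul, Real.norm_of_nonneg (dampedKernel_nonneg 1 z)]
    exact mul_le_mul_of_nonneg_left (hC _ _) (dampedKernel_nonneg 1 z)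
  · filter_upwards with z
    exact continuous_const.mul (hv.comp (f := fun q : ℝ × ℝ => (x + Real.sqrt q.1 * z, q.2))
      (by fun_prop))

/-- A continuous probability density on `[0,T]` supported in `[T - ε, T]`. -/
def rampDensity (T ε s : ℝ) : ℝ :=
  max 0 (s - (T - ε)) / ∫ σ in (0:ℝ)..T, max 0 (σ - (T - ε))

lemma integral_ramp_pos {T ε : ℝ} (hT : 0 < T) (hε : 0 < ε) :
    0 < ∫ σ in (0:ℝ)..T, max 0 (σ - (T - ε)) :=
  intervalIntegral.integral_pos hT (by fun_prop) (fun _ _ => le_max_left _ _)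
    ⟨T, ⟨hT.le, le_rfl⟩, by simp [hε]⟩

lemma continuous_rampDensity (T ε : ℝ) : Continuous (rampDensity T ε) := by
  unfold rampDensity
  exact Continuous.div_const (by fun_prop) _

lemma rampDensity_nonneg {T ε : ℝ} (hT : 0 < T) (hε : 0 < ε) (s : ℝ) : 0 ≤ rampDensity T ε s :=
  div_nonneg (le_max_left _ _) (integral_ramp_pos hT hε).le

lemma integral_rampDensity {T ε : ℝ} (hT : 0 < T) (hε : 0 < ε) :
    ∫ s in (0:ℝ)..T, rampDensity T ε s = 1 := by
  unfold rampDensity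
  rw [intervalIntegral.integral_div, div_self (integral_ramp_pos hT hε).ne']

lemma rampDensity_eq_zero {T ε s : ℝ} (hs : s ≤ T - ε) : rampDensity T ε s = 0 := by
  rw [rampDensity, max_eq_left (by linarith), zero_div]

lemma integral_rampDensity_mem_Icc {T ε s : ℝ} (hT : 0 < T) (hε : 0 < ε) (hs : s ∈ Icc 0 T) :
    ∫ σ in s..T, rampDensity T ε σ ∈ Icc (0:ℝ) 1 := by
  have hi : ∀ a b, IntervalIntegrable (rampDensity T ε) volume a b := fun a b =>
    (continuous_rampDensity T ε).intervalIntegrable a b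
  refine ⟨intervalIntegral.integral_nonneg hs.2 fun σ _ => rampDensity_nonneg hT hε σ, ?_⟩
  have h0 : 0 ≤ ∫ σ in (0:ℝ)..s, rampDensity T ε σ :=
    intervalIntegral.integral_nonneg hs.1 fun σ _ => rampDensity_nonneg hT hε σ
  have := intervalIntegral.integral_add_adjacent_intervals (hi 0 s) (hi s T)
  rw [integral_rampDensity hT hε] at this
  linarith

lemma tendsto_integral_rampDensity_mul {T : ℝ} (hT : 0 < T) {Φ : ℝ → ℝ → ℝ}
    (hΦ : Continuous (fun q : ℝ × ℝ => Φ q.1 q.2)) :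
    Tendsto (fun ε => ∫ s in Ioc 0 T, rampDensity T ε s * Φ (T + ε - s) s)
      (nhdsWithin 0 (Ioi 0)) (nhds (Φ 0 T)) := by
  rw [Metric.tendsto_nhds]
  intro c hc
  obtain ⟨δ, hδ, hδc⟩ := Metric.continuousAt_iff.1 (hΦ.continuousAt (x := (0, T))) (c / 2)
    (half_pos hc)
  filter_upwards [Ioo_mem_nhdsGT (half_pos hδ)] with ε hε
  have hε0 : 0 < ε := hε.1
  have hcont : Continuous fun s => rampDensity T ε s * Φ (T + ε - s) s :=
    (continuous_rampDensity T ε).mul (hΦ.comp (f := fun s => (T + ε - s, s)) (by fun_prop))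
  have hcont' : Continuous fun s => rampDensity T ε s * Φ 0 T :=
    (continuous_rampDensity T ε).mul_const _
  have e1 : Φ 0 T = ∫ s in (0:ℝ)..T, rampDensity T ε s * Φ 0 T := by
    rw [intervalIntegral.integral_mul_const, integral_rampDensity hT hε0, one_mul]
  have e2 : (c / 2) = ∫ s in (0:ℝ)..T, rampDensity T ε s * (c / 2) := by
    rw [intervalIntegral.integral_mul_const, integral_rampDensity hT hε0, one_mul]
  rw [← intervalIntegral.integral_of_le hT.le, Real.dist_eq]
  conv_lhs => rw [e1]
  rw [← intervalIntegral.integral_sub (hcont.intervalIntegrable _ _)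
    (hcont'.intervalIntegrable _ _)]
  refine lt_of_le_of_lt ?_ (half_lt_self hc)
  refine (intervalIntegral.abs_integral_le_integral_abs hT.le).trans ?_
  rw [e2]
  refine intervalIntegral.integral_mono_on hT.le
    ((hcont.sub hcont').abs.intervalIntegrable _ _)
    (((continuous_rampDensity T ε).mul_const _).intervalIntegrable _ _) fun s hs => ?_
  rw [← mul_sub, abs_mul, abs_of_nonneg (rampDensity_nonneg hT hε0 s)]
  rcases le_or_gt s (T - ε) with h | h
  · simp [rampDensity_eq_zero h]
  · refine mul_le_mul_of_nonneg_left ?_ (rampDensity_nonneg hT hε0 s)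
    have := @hδc (T + ε - s, s) (by
      rw [Prod.dist_eq, Real.dist_eq, Real.dist_eq, max_lt_iff, abs_lt, abs_lt]
      have h1 := hε.2
      have h2 := hs.2
      refine ⟨⟨?_, ?_⟩, ?_, ?_⟩ <;> simp only <;> linarith)
    exact this.le

lemma integral_exp_neg_shift (T ε : ℝ) :
    ∫ s in (0:ℝ)..T, Real.exp (-(T + ε - s)) = Real.exp (-ε) * (1 - Real.exp (-T)) := by
  have hd : ∀ s ∈ uIcc 0 T, HasDerivAt (fun s => Real.exp (-(T + ε - s)))
      (Real.exp (-(T + ε - s))) s := fun s _ => by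
    simpa using ((hasDerivAt_id s).const_sub (T + ε)).neg.exp
  rw [intervalIntegral.integral_eq_sub_of_hasDerivAt hd
    ((by fun_prop : Continuous fun s : ℝ => Real.exp (-(T + ε - s))).intervalIntegrable _ _),
    mul_sub, ← Real.exp_add, mul_one, show -(T + ε - T) = -ε by ring,
    show -(T + ε - 0) = -ε + -T by ring]

lemma integral_exp_neg_mul_inv_sqrt_le {T ε : ℝ} (hT : 0 < T) (hε : 0 < ε) :
    ∫ s in Ioc 0 T, Real.exp (-(T + ε - s)) * (Real.sqrt (Real.pi * (T + ε - s)))⁻¹ ≤ 1 := by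
  have hΓ := Real.GammaIntegral_convergent (s := 1 / 2) (by norm_num)
  have h1 : ∫ s in Ioc 0 T, Real.exp (-(T + ε - s)) * (Real.sqrt (Real.pi * (T + ε - s)))⁻¹ =
      ∫ r in Ioc ε (T + ε), Real.exp (-r) * (Real.sqrt (Real.pi * r))⁻¹ := by
    rw [← intervalIntegral.integral_of_le hT.le, ← intervalIntegral.integral_of_le (by linarith),
      intervalIntegral.integral_comp_sub_left
        (fun r => Real.exp (-r) * (Real.sqrt (Real.pi * r))⁻¹) (T + ε)]
    simp
  have h2 : ∀ r ∈ Ioi (0:ℝ), Real.exp (-r) * (Real.sqrt (Real.pi * r))⁻¹ =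
      (Real.sqrt Real.pi)⁻¹ * (Real.exp (-r) * r ^ ((1 / 2 : ℝ) - 1)) := fun r hr => by
    have hr : 0 < r := hr
    rw [Real.sqrt_mul Real.pi_pos.le, mul_inv, show ((1 / 2 : ℝ) - 1) = -(1 / 2) by norm_num,
      Real.rpow_neg hr.le, ← Real.sqrt_eq_rpow]
    ring
  have hsub : Ioc ε (T + ε) ⊆ Ioi (0:ℝ) := fun r hr => hε.trans hr.1
  rw [h1, setIntegral_congr_fun measurableSet_Ioc fun r hr => h2 r (hsub hr), integral_const_mul]
  have h3 : ∫ r in Ioc ε (T + ε), Real.exp (-r) * r ^ ((1 / 2 : ℝ) - 1) ≤ Real.sqrt Real.pi := by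
    rw [← Real.Gamma_one_half_eq, Real.Gamma_eq_integral (by norm_num)]
    refine setIntegral_mono_set hΓ ?_ hsub.eventuallyLE
    filter_upwards [ae_restrict_mem measurableSet_Ioi] with r hr
    have hr : 0 < r := hr
    simp only [Pi.zero_apply]
    positivity
  rw [inv_mul_le_iff₀ (Real.sqrt_pos.2 Real.pi_pos), mul_one]
  exact h3

section Bounds

variable {T C N : ℝ} {v w f : ℝ → ℝ → ℝ}

lemma IsBoundedHeatSolution.tendsto_average (h : IsBoundedHeatSolution T C v w f) (hT : 0 < T)
    (x : ℝ) :
    Tendsto (fun ε => ∫ s in Ioc 0 T, (∫ σ in s..T, rampDensity T ε σ) *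
      ∫ y, dampedKernel (T + ε - s) (y - x) * (v y s - f y s))
      (nhdsWithin 0 (Ioi 0)) (nhds (v x T)) := by
  have h1 := tendsto_integral_rampDensity_mul hT
    (continuous_dampedAverage h.continuous_v h.abs_v_le x)
  rw [dampedAverage_zero] at h1
  refine h1.congr' ?_
  filter_upwards [self_mem_nhdsWithin] with ε hε
  rw [← (h.integral_mul_average hε x (continuous_rampDensity T ε)).2]
  refine setIntegral_congr_fun measurableSet_Ioc fun s hs => ?_
  have : 0 < T + ε - s := by linarith [hs.2, show 0 < ε from hε]
  simp only [integral_dampedKernel_mul this]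

/-- Maximum principle. -/
lemma IsBoundedHeatSolution.abs_le (h : IsBoundedHeatSolution T C v w f) (hT : 0 < T)
    (hN : ∀ y, ∀ s ∈ Ioc 0 T, |v y s - f y s| ≤ N) (x : ℝ) :
    |v x T| ≤ N * (1 - Real.exp (-T)) := by
  have hN0 : 0 ≤ N := (abs_nonneg _).trans (hN 0 T ⟨hT, le_rfl⟩)
  refine le_of_tendsto (h.tendsto_average hT x).abs ?_
  filter_upwards [self_mem_nhdsWithin] with ε hε
  have hε : 0 < ε := hε
  have hexp : IntegrableOn (fun s => N * Real.exp (-(T + ε - s))) (Ioc 0 T) :=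
    (by fun_prop : Continuous fun s => N * Real.exp (-(T + ε - s))).integrableOn_Ioc
  refine (norm_integral_le_of_norm_le (G := ℝ) hexp ?_).trans ?_
  · filter_upwards [ae_restrict_mem measurableSet_Ioc] with s hs
    have hr : 0 < T + ε - s := by linarith [hs.2]
    obtain ⟨hη0, hη1⟩ := integral_rampDensity_mem_Icc hT hε (Ioc_subset_Icc_self hs)
    rw [norm_mul, Real.norm_of_nonneg hη0]
    have hJ : ‖∫ y, dampedKernel (T + ε - s) (y - x) * (v y s - f y s)‖ ≤
        N * Real.exp (-(T + ε - s)) := by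
      have hk := (integrable_dampedKernel hr).comp_sub_right x
      refine (norm_integral_le_of_norm_le (hk.const_mul N) ?_).trans_eq ?_
      · filter_upwards with y
        rw [norm_mul, Real.norm_of_nonneg (dampedKernel_nonneg _ _), mul_comm]
        exact mul_le_mul_of_nonneg_right (hN y s hs) (dampedKernel_nonneg _ _)
      · rw [integral_const_mul, integral_sub_right_eq_self (dampedKernel (T + ε - s)) x,
          integral_dampedKernel hr]
    calc _ ≤ 1 * (N * Real.exp (-(T + ε - s))) := by gcongr
      _ = _ := one_mul _
  · rw [integral_const_mul, ← intervalIntegral.integral_of_le hT.le, integral_exp_neg_shift]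
    have h1 : Real.exp (-ε) ≤ 1 := Real.exp_le_one_iff.2 (by linarith)
    have h2 : 0 ≤ 1 - Real.exp (-T) := sub_nonneg.2 (Real.exp_le_one_iff.2 (by linarith))
    gcongr
    calc _ ≤ 1 * (1 - Real.exp (-T)) := by gcongr
      _ = _ := one_mul _

/-- Spatial Lipschitz estimate. -/
lemma IsBoundedHeatSolution.abs_sub_le (h : IsBoundedHeatSolution T C v w f) (hT : 0 < T)
    (hN : ∀ y, ∀ s ∈ Ioc 0 T, |v y s - f y s| ≤ N) (a b : ℝ) :
    |v b T - v a T| ≤ N * |b - a| := by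
  have hN0 : 0 ≤ N := (abs_nonneg _).trans (hN 0 T ⟨hT, le_rfl⟩)
  refine le_of_tendsto ((h.tendsto_average hT b).sub (h.tendsto_average hT a)).abs ?_
  filter_upwards [self_mem_nhdsWithin] with ε hε
  have hε : 0 < ε := hε
  have hθ := continuous_rampDensity T ε
  rw [← integral_sub (h.integral_mul_average hε b hθ).1 (h.integral_mul_average hε a hθ).1]
  set G : ℝ → ℝ := fun s => Real.exp (-(T + ε - s)) * (Real.sqrt (Real.pi * (T + ε - s)))⁻¹
    with hG
  have hGi : IntegrableOn (fun s => N * |b - a| * G s) (Ioc 0 T) := by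
    rw [← integrableOn_Icc_iff_integrableOn_Ioc]
    refine ContinuousOn.integrableOn_Icc ?_
    refine continuousOn_const.mul (ContinuousOn.mul (by fun_prop) (ContinuousOn.inv₀ (by fun_prop)
      fun s hs => (Real.sqrt_pos.2 ?_).ne'))
    have : 0 < T + ε - s := by linarith [hs.2]
    positivity
  refine (norm_integral_le_of_norm_le (G := ℝ) hGi ?_).trans ?_
  · filter_upwards [ae_restrict_mem measurableSet_Ioc] with s hs
    have hr : 0 < T + ε - s := by linarith [hs.2]
    obtain ⟨hη0, hη1⟩ := integral_rampDensity_mem_Icc hT hε (Ioc_subset_Icc_self hs)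
    rw [← mul_sub, norm_mul, Real.norm_of_nonneg hη0]
    have hk : ∀ x, Integrable (fun y => dampedKernel (T + ε - s) (y - x)) := fun x =>
      (integrable_dampedKernel hr).comp_sub_right x
    have hm : AEStronglyMeasurable (fun y => v y s - f y s) :=
      ((h.continuous_v.measurable.sub h.measurable_f).comp
        measurable_prodMk_right).aestronglyMeasurable
    have hki : ∀ x, Integrable (fun y => dampedKernel (T + ε - s) (y - x) * (v y s - f y s)) :=
      fun x => (hk x).mul_bdd (c := N) hm (Eventually.of_forall fun y => hN y s hs)
    have hJ : ‖(∫ y, dampedKernel (T + ε - s) (y - b) * (v y s - f y s)) -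
        ∫ y, dampedKernel (T + ε - s) (y - a) * (v y s - f y s)‖ ≤ N * |b - a| * G s := by
      rw [← integral_sub (hki b) (hki a)]
      refine (norm_integral_le_of_norm_le ((((hk b).sub (hk a)).abs).const_mul N) ?_).trans ?_
      · filter_upwards with y
        rw [← sub_mul, norm_mul, mul_comm]
        exact mul_le_mul_of_nonneg_right (hN y s hs) (abs_nonneg _)
      · rw [integral_const_mul]
        calc _ ≤ N * (G s * |b - a|) :=
              mul_le_mul_of_nonneg_left (integral_abs_sub_dampedKernel_le hr a b) hN0
          _ = _ := by ring
    calc _ ≤ 1 * (N * |b - a| * G s) := by gcongr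
      _ = _ := one_mul _
  · rw [integral_const_mul]
    calc _ ≤ N * |b - a| * 1 := by
          gcongr
          exact integral_exp_neg_mul_inv_sqrt_le hT hε
      _ = _ := mul_one _

end Bounds

lemma integrableOn_gaussian_tail (a : ℝ) :
    IntegrableOn (fun ζ : ℝ => Real.exp (-ζ ^ 2 / 4)) (Ioi a) := by
  have h := integrable_exp_neg_mul_sq (b := 1 / 4) (by norm_num)
  refine (h.congr (Eventually.of_forall fun ζ => ?_)).integrableOn
  simp only
  congr 1
  ring

lemma antitone_gaussian_tail :
    Antitone fun a : ℝ => ∫ ζ in Ioi a, Real.exp (-ζ ^ 2 / 4) := fun a _ hab =>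
  setIntegral_mono_set (integrableOn_gaussian_tail a)
    (Eventually.of_forall fun _ => (Real.exp_pos _).le) (Ioi_subset_Ioi hab).eventuallyLE

lemma abs_gaussian_tail_sub_le (a b : ℝ) :
    |(∫ ζ in Ioi b, Real.exp (-ζ ^ 2 / 4)) - ∫ ζ in Ioi a, Real.exp (-ζ ^ 2 / 4)| ≤ |b - a| := by
  rw [abs_sub_comm, intervalIntegral.integral_Ioi_sub_Ioi' (integrableOn_gaussian_tail a)
    (integrableOn_gaussian_tail b)]
  have h := intervalIntegral.norm_integral_le_of_norm_le_const (a := a) (b := b) (C := 1)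
    (f := fun ζ : ℝ => Real.exp (-ζ ^ 2 / 4)) fun ζ _ => by
      rw [Real.norm_of_nonneg (Real.exp_pos _).le]
      exact Real.exp_le_one_iff.2 (by nlinarith [sq_nonneg ζ])
  rwa [one_mul] at h

section Psi

variable {α β : ℝ}

lemma measurable_psi (α β : ℝ) : Measurable (fun q : ℝ × ℝ => psi α β q.1 q.2) := by
  unfold psi
  refine Measurable.ite (measurableSet_lt measurable_const measurable_snd) ?_ measurable_const
  refine measurable_const.mul (antitone_gaussian_tail.measurable.comp ?_)
  fun_prop

lemma exists_abs_psi_le (hα : 0 < α) (hβ : 0 < β) : ∃ M, 0 ≤ M ∧ ∀ x t, |psi α β x t| ≤ M := by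
  have hI : ∀ a : ℝ, 0 ≤ ∫ ζ in Ioi a, Real.exp (-ζ ^ 2 / 4) := fun a =>
    integral_nonneg fun ζ => (Real.exp_pos _).le
  refine ⟨α * β / 2 * Real.exp (α ^ 2 / 4) * ∫ ζ in Ioi α, Real.exp (-ζ ^ 2 / 4),
    mul_nonneg (by positivity) (hI α), fun x t => ?_⟩
  unfold psi
  split_ifs
  · rw [abs_of_nonneg (mul_nonneg (by positivity) (hI _))]
    exact mul_le_mul_of_nonneg_left (antitone_gaussian_tail (le_max_right _ _)) (by positivity)
  · rw [abs_zero]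
    exact mul_nonneg (by positivity) (hI α)

lemma abs_psi_sub_le (hα : 0 < α) (hβ : 0 < β) {T t : ℝ} (hT : 0 < T) (ht : T ≤ t) (x y : ℝ) :
    |psi α β y t - psi α β x t| ≤
      α * β / 2 * Real.exp (α ^ 2 / 4) * (Real.sqrt T)⁻¹ * |y - x| := by
  have ht0 : 0 < t := hT.trans_le ht
  unfold psi
  rw [if_pos ht0, if_pos ht0, ← mul_sub, abs_mul,
    abs_of_nonneg (by positivity : 0 ≤ α * β / 2 * Real.exp (α ^ 2 / 4)), mul_assoc _ _ |y - x|]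
  refine mul_le_mul_of_nonneg_left ?_ (by positivity)
  refine (abs_gaussian_tail_sub_le _ _).trans ((abs_max_sub_max_le_abs _ _ _).trans ?_)
  rw [← sub_div, abs_div, abs_of_pos (Real.sqrt_pos.2 ht0), div_eq_inv_mul]
  have hs := Real.sqrt_pos.2 hT
  exact mul_le_mul (inv_anti₀ hs (Real.sqrt_le_sqrt ht)) (abs_abs_sub_abs_le _ _) (abs_nonneg _)
    (by positivity)

end Psi

lemma IsWeakSolution.p_mem_Icc {α β ustar : ℝ} {u p : ℝ → ℝ → ℝ}
    (h : IsWeakSolution α β ustar u p) (x : ℝ) {t : ℝ} (ht : 0 ≤ t) : p x t ∈ Icc (0:ℝ) 1 := by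
  obtain ⟨h1, h2, h3⟩ := h.2.2.2.1 x t ht
  rcases lt_trichotomy (sSup ((fun s => u x s) '' Icc 0 t)) ustar with hs | hs | hs
  · simp [h1 hs]
  · exact h2 hs
  · simp [h3 hs]

/-- On a finite time horizon, `u - ψ` extends to a bounded heat solution with sink `p u`. -/
lemma IsWeakSolution.exists_isBoundedHeatSolution {α β ustar : ℝ} (hα : 0 < α) (hβ : 0 < β)
    {u p : ℝ → ℝ → ℝ} (h : IsWeakSolution α β ustar u p) {T : ℝ} (hT : 0 < T) :
    ∃ (C : ℝ) (v w f : ℝ → ℝ → ℝ), IsBoundedHeatSolution T C v w f ∧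
      (∀ x, ∀ t ∈ Icc 0 T, v x t = u x t - psi α β x t) ∧
      ∀ x, ∀ t ∈ Icc 0 T, f x t = p x t * u x t := by
  have hp := fun x t ht => h.p_mem_Icc x (t := t) ht
  obtain ⟨-, -, hpm, -, -, w, ⟨hd, hvc, hwc, hb⟩, hweak⟩ := h
  obtain ⟨C, hC⟩ := hb T hT
  obtain ⟨M, hM0, hM⟩ := exists_abs_psi_le hα hβ
  have hC0 : 0 ≤ C := (abs_nonneg _).trans (hC 0 0 ⟨le_rfl, hT.le⟩).1
  set κ : ℝ → ℝ := fun t => max 0 (min t T) with hκ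
  have hκc : Continuous κ := by fun_prop
  have hκm : ∀ t, κ t ∈ Icc 0 T := fun t =>
    ⟨le_max_left _ _, max_le hT.le (min_le_right _ _)⟩
  have hκe : ∀ t ∈ Icc 0 T, κ t = t := fun t ht => by
    simp only [hκ]
    rw [min_eq_left ht.2, max_eq_right ht.1]
  set v : ℝ → ℝ → ℝ := fun x t => u x (κ t) - psi α β x (κ t) with hv
  set w' : ℝ → ℝ → ℝ := fun x t => w x (κ t) with hw'
  set f : ℝ → ℝ → ℝ := fun x t => p x (κ t) * (v x t + psi α β x (κ t)) with hf
  have hclamp : Continuous fun q : ℝ × ℝ => (q.1, κ q.2) := by fun_prop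
  have hclampm : ∀ q : ℝ × ℝ, (q.1, κ q.2) ∈ (univ : Set ℝ) ×ˢ Ici (0:ℝ) := fun q =>
    ⟨trivial, (hκm _).1⟩
  have hvcont : Continuous fun q : ℝ × ℝ => v q.1 q.2 := hvc.comp_continuous hclamp hclampm
  have hve : ∀ x, ∀ t ∈ Icc 0 T, v x t = u x t - psi α β x t := fun x t ht => by
    simp only [hv, hκe t ht]
  have hfe : ∀ x, ∀ t ∈ Icc 0 T, f x t = p x t * u x t := fun x t ht => by
    simp only [hf, hve x t ht, hκe t ht, sub_add_cancel]
  refine ⟨C + M, v, w', f, ⟨hvcont, hwc.comp_continuous hclamp hclampm, ?_, fun x t => ?_,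
    fun x t => ?_, fun x t => ?_, fun x t => hd _ (hκm t).1 x, fun φ φt φx hφ => ?_⟩, hve, hfe⟩
  · exact (hpm.comp hclamp.measurable).mul
      (hvcont.measurable.add ((measurable_psi α β).comp hclamp.measurable))
  · linarith [(hC x _ (hκm t)).1]
  · linarith [(hC x _ (hκm t)).2]
  · obtain ⟨hp0, hp1⟩ := hp x (κ t) (hκm t).1
    rw [abs_mul, abs_of_nonneg hp0]
    calc _ ≤ 1 * (C + M) := by
          gcongr
          exact (abs_add_le _ _).trans (add_le_add (hC x _ (hκm t)).1 (hM _ _))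
      _ = _ := one_mul _
  · have h0 := hweak T hT φ φt φx hφ
    refine Eq.trans ?_ (h0.trans ?_) <;>
    refine setIntegral_congr_fun measurableSet_Ioc fun t ht => integral_congr_ae
      (Eventually.of_forall fun x => ?_)
    · simp only [hve x t (Ioc_subset_Icc_self ht)]
    · simp only [hfe x t (Ioc_subset_Icc_self ht), hw', hκe t (Ioc_subset_Icc_self ht)]

lemma abs_sub_mul_le {a b q N : ℝ} (hq : q ∈ Icc (0:ℝ) 1) (ha : |a - b| ≤ N) (hb : |b| ≤ N) :
    |(a - b) - q * a| ≤ N := by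
  obtain ⟨hq0, hq1⟩ := hq
  rw [abs_le] at *
  constructor <;>
  nlinarith [mul_le_mul_of_nonneg_left ha.1 (sub_nonneg.2 hq1),
    mul_le_mul_of_nonneg_left ha.2 (sub_nonneg.2 hq1), mul_le_mul_of_nonneg_left hb.1 hq0,
    mul_le_mul_of_nonneg_left hb.2 hq0]

lemma IsWeakSolution.abs_sub_psi_le_of_bound {α β ustar N : ℝ} (hα : 0 < α) (hβ : 0 < β)
    {u p : ℝ → ℝ → ℝ} (h : IsWeakSolution α β ustar u p) (hψ : ∀ x t, |psi α β x t| ≤ N)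
    {T : ℝ} (hT : 0 < T) (hN : ∀ y, ∀ s ∈ Ioc 0 T, |u y s - psi α β y s| ≤ N) (x : ℝ) :
    |u x T - psi α β x T| ≤ N * (1 - Real.exp (-T)) := by
  obtain ⟨C, v, w, f, hs, hv, hf⟩ := h.exists_isBoundedHeatSolution hα hβ hT
  rw [← hv x T ⟨hT.le, le_rfl⟩]
  refine hs.abs_le hT (fun y s hs => ?_) x
  rw [hv y s (Ioc_subset_Icc_self hs), hf y s (Ioc_subset_Icc_self hs)]
  exact abs_sub_mul_le (h.p_mem_Icc y hs.1.le) (hN y s hs) (hψ y s)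

/-- `u - ψ` is bounded uniformly in time by any bound for `ψ`. -/
lemma IsWeakSolution.abs_sub_psi_le {α β ustar M : ℝ} (hα : 0 < α) (hβ : 0 < β)
    {u p : ℝ → ℝ → ℝ} (h : IsWeakSolution α β ustar u p) (hM0 : 0 ≤ M)
    (hM : ∀ x t, |psi α β x t| ≤ M) {t : ℝ} (ht : 0 < t) (x : ℝ) :
    |u x t - psi α β x t| ≤ M := by
  obtain ⟨C, v, w, f, hs, hv, -⟩ := h.exists_isBoundedHeatSolution hα hβ ht
  set A : Set ℝ := (fun q : ℝ × ℝ => |u q.1 q.2 - psi α β q.1 q.2|) '' (univ ×ˢ Ioc 0 t) with hA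
  have hbdd : BddAbove A := by
    refine ⟨C, ?_⟩
    rintro _ ⟨q, hq, rfl⟩
    simpa only [← hv q.1 q.2 (Ioc_subset_Icc_self hq.2)] using hs.abs_v_le q.1 q.2
  have hle : ∀ y, ∀ s ∈ Ioc 0 t, |u y s - psi α β y s| ≤ sSup A := fun y s hs =>
    le_csSup hbdd ⟨(y, s), ⟨trivial, hs⟩, rfl⟩
  have hN0 : 0 ≤ max (sSup A) M := hM0.trans (le_max_right _ _)
  have hsup : sSup A ≤ max (sSup A) M * (1 - Real.exp (-t)) := by
    refine csSup_le ⟨_, (x, t), ⟨trivial, ht, le_rfl⟩, rfl⟩ ?_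
    rintro _ ⟨q, ⟨-, hq0, hqt⟩, rfl⟩
    refine (h.abs_sub_psi_le_of_bound hα hβ (fun y s => (hM y s).trans (le_max_right _ _)) hq0
      (fun y s hs => (hle y s ⟨hs.1, hs.2.trans hqt⟩).trans (le_max_left _ _)) q.1).trans ?_
    gcongr
  refine (hle x t ⟨ht, le_rfl⟩).trans ?_
  by_contra! hlt
  rw [max_eq_left hlt.le] at hsup
  nlinarith [mul_pos (hM0.trans_lt hlt) (Real.exp_pos (-t))]

/-- the concentration of a weak solution is Lipschitz continuous in
space, uniformly in time, on `ℝ × [T, ∞)` for every `T > 0`. -/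
theorem concentration_uniformly_lipschitz (α β ustar : ℝ)
    (hα : 0 < α) (hβ : 0 < β) (hu : 0 < ustar)
    (u p : ℝ → ℝ → ℝ) (hsol : IsWeakSolution α β ustar u p) :
    ∀ T > (0:ℝ), ∃ L : ℝ, ∀ x₁ x₂ t : ℝ, T ≤ t →
      |u x₂ t - u x₁ t| ≤ L * |x₂ - x₁| := by
  intro T hT
  obtain ⟨M, hM0, hM⟩ := exists_abs_psi_le hα hβ
  refine ⟨M + α * β / 2 * Real.exp (α ^ 2 / 4) * (Real.sqrt T)⁻¹, fun x₁ x₂ t ht => ?_⟩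
  have ht0 : 0 < t := hT.trans_le ht
  obtain ⟨C, v, w, f, hs, hv, hf⟩ := hsol.exists_isBoundedHeatSolution hα hβ ht0
  have hlip := hs.abs_sub_le ht0 (N := M) (fun y s hs => by
    rw [hv y s (Ioc_subset_Icc_self hs), hf y s (Ioc_subset_Icc_self hs)]
    exact abs_sub_mul_le (hsol.p_mem_Icc y hs.1.le)
      (hsol.abs_sub_psi_le hα hβ hM0 hM hs.1 y) (hM y s)) x₁ x₂
  rw [hv x₁ t ⟨ht0.le, le_rfl⟩, hv x₂ t ⟨ht0.le, le_rfl⟩] at hlip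
  have hψ := abs_psi_sub_le hα hβ hT ht x₁ x₂
  calc |u x₂ t - u x₁ t|
      = |((u x₂ t - psi α β x₂ t) - (u x₁ t - psi α β x₁ t)) +
          (psi α β x₂ t - psi α β x₁ t)| := by ring_nf
    _ ≤ _ := (abs_add_le _ _).trans (add_le_add hlip hψ)
    _ = _ := (add_mul _ _ _).symm

end
end

section
/- Let α, β, u* > 0. The matching equation u*_γ = u* has a unique solution γ > 0 if and only if u* < u*₀. Moreover, when u* < u*₀ and γ > 0 is this solution, the profile Φ_γ is the unique function Φ : [0,∞) → ℝ that is continuous on [0,∞), twice continuously differentiable on (0,α) and on (α,∞) with one-sided first derivatives at η = α and a right derivative at η = 0, and satisfies: Φ''(η) + (η/2)·Φ'(η) − (γ/η²)·Φ(η) = 0 for η ∈ (0,α); Φ''(η) + (η/2)·Φ'(η) = 0 for η ∈ (α,∞); the jump condition Φ'(α+) − Φ'(α−) = −αβ/2; Φ(α) = u*; Φ'(0) = 0; and Φ(η) → 0 as η → ∞. -/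
open MeasureTheory Filter Set

noncomputable section

/-- `Φ` solves the stationary boundary value problem for the self-similar precipitation
function with constant `γ`: continuous on `[0,∞)`, twice continuously differentiable on
`(0,α)` and `(α,∞)`, satisfies the two ODEs, the jump condition for the one-sided
derivatives at `η = α`, `Φ(α) = u*`, `Φ'(0) = 0` (right derivative), and decay at `∞`. -/
def IsProfileSolution (α β ustar γ : ℝ) (Φ : ℝ → ℝ) : Prop :=
  ContinuousOn Φ (Set.Ici 0) ∧
  Φ α = ustar ∧
  Filter.Tendsto Φ Filter.atTop (nhds 0) ∧
  ∃ Φ' Φ'' : ℝ → ℝ,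
    (∀ η ∈ Set.Ioo (0:ℝ) α, HasDerivAt Φ (Φ' η) η) ∧
    (∀ η ∈ Set.Ioo (0:ℝ) α, HasDerivAt Φ' (Φ'' η) η) ∧
    (∀ η ∈ Set.Ioi α, HasDerivAt Φ (Φ' η) η) ∧
    (∀ η ∈ Set.Ioi α, HasDerivAt Φ' (Φ'' η) η) ∧
    ContinuousOn Φ'' (Set.Ioo (0:ℝ) α) ∧ ContinuousOn Φ'' (Set.Ioi α) ∧
    (∀ η ∈ Set.Ioo (0:ℝ) α, Φ'' η + (η / 2) * Φ' η - (γ / η ^ 2) * Φ η = 0) ∧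
    (∀ η ∈ Set.Ioi α, Φ'' η + (η / 2) * Φ' η = 0) ∧
    (∃ dL dR : ℝ, HasDerivWithinAt Φ dL (Set.Iic α) α ∧
      HasDerivWithinAt Φ dR (Set.Ici α) α ∧ dR - dL = -(α * β / 2)) ∧
    HasDerivWithinAt Φ 0 (Set.Ici 0) 0

/-! ### Kummer's function -/

/-- The quotient of rising factorials in the Kummer series. -/
def kummerCoeff (a b : ℝ) (n : ℕ) : ℝ :=
  Polynomial.eval a (ascPochhammer ℝ n) / Polynomial.eval b (ascPochhammer ℝ n)

theorem kummerM_eq_tsum (a b z : ℝ) :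
    kummerM a b z = ∑' n : ℕ, kummerCoeff a b n * z ^ n / (n.factorial : ℝ) := rfl

theorem ascPochhammer_eval_succ_left (a : ℝ) (n : ℕ) :
    Polynomial.eval a (ascPochhammer ℝ (n + 1)) =
      a * Polynomial.eval (a + 1) (ascPochhammer ℝ n) := by
  simp [ascPochhammer_succ_left, Polynomial.eval_comp]

@[simp]
theorem kummerCoeff_zero (a b : ℝ) : kummerCoeff a b 0 = 1 := by
  simp [kummerCoeff]

theorem kummerCoeff_succ (a b : ℝ) (n : ℕ) :
    kummerCoeff a b (n + 1) = kummerCoeff a b n * ((a + n) / (b + n)) := by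
  simp only [kummerCoeff, ascPochhammer_succ_eval]
  rw [div_mul_div_comm]

theorem mul_kummerCoeff_add_one (a b : ℝ) (n : ℕ) :
    a * kummerCoeff (a + 1) b n = (a + n) * kummerCoeff a b n := by
  have h := ascPochhammer_eval_succ_left a n
  rw [ascPochhammer_succ_eval] at h
  simp only [kummerCoeff, ← mul_div_assoc, ← h]
  ring

theorem kummerCoeff_nonneg {a b : ℝ} (ha : 0 ≤ a) (hb : 0 < b) (n : ℕ) :
    0 ≤ kummerCoeff a b n := by
  induction n with
  | zero => simp
  | succ n ih => rw [kummerCoeff_succ]; positivity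

theorem kummerCoeff_le_one {a b : ℝ} (ha : 0 ≤ a) (hab : a ≤ b) (hb : 0 < b) (n : ℕ) :
    kummerCoeff a b n ≤ 1 := by
  induction n with
  | zero => simp
  | succ n ih =>
    rw [kummerCoeff_succ]
    exact mul_le_one₀ ih (by positivity) (div_le_one_of_le₀ (by linarith) (by positivity))

theorem norm_kummerM_term_le {a b : ℝ} (ha : 0 ≤ a) (hab : a ≤ b) (hb : 0 < b) (z : ℝ) (n : ℕ) :
    ‖kummerCoeff a b n * z ^ n / (n.factorial : ℝ)‖ ≤ |z| ^ n / (n.factorial : ℝ) := by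
  rw [norm_div, norm_mul, norm_pow, Real.norm_natCast, Real.norm_eq_abs, Real.norm_eq_abs,
    abs_of_nonneg (kummerCoeff_nonneg ha hb n)]
  gcongr
  exact mul_le_of_le_one_left (by positivity) (kummerCoeff_le_one ha hab hb n)

theorem summable_norm_kummerM_term {a b : ℝ} (ha : 0 ≤ a) (hab : a ≤ b) (hb : 0 < b) (z : ℝ) :
    Summable fun n : ℕ => ‖kummerCoeff a b n * z ^ n / (n.factorial : ℝ)‖ :=
  (Real.summable_pow_div_factorial |z|).of_nonneg_of_le (fun _ => norm_nonneg _)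
    (norm_kummerM_term_le ha hab hb z)

theorem summable_kummerM_term {a b : ℝ} (ha : 0 ≤ a) (hab : a ≤ b) (hb : 0 < b) (z : ℝ) :
    Summable fun n : ℕ => kummerCoeff a b n * z ^ n / (n.factorial : ℝ) :=
  (summable_norm_kummerM_term ha hab hb z).of_norm

theorem exp_eq_tsum_div (z : ℝ) : Real.exp z = ∑' n : ℕ, z ^ n / (n.factorial : ℝ) := by
  rw [Real.exp_eq_exp_ℝ, NormedSpace.exp_eq_tsum_div]

theorem one_le_kummerM {a b z : ℝ} (ha : 0 ≤ a) (hab : a ≤ b) (hb : 0 < b) (hz : 0 ≤ z) :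
    1 ≤ kummerM a b z := by
  have h := (summable_kummerM_term ha hab hb z).le_tsum 0 fun n _ => by
    have := kummerCoeff_nonneg ha hb n
    positivity
  simpa [kummerM_eq_tsum] using h

theorem kummerM_le_exp {a b z : ℝ} (ha : 0 ≤ a) (hab : a ≤ b) (hb : 0 < b) (hz : 0 ≤ z) :
    kummerM a b z ≤ Real.exp z := by
  rw [exp_eq_tsum_div, kummerM_eq_tsum]
  refine (summable_kummerM_term ha hab hb z).tsum_le_tsum (fun n => ?_)
    (Real.summable_pow_div_factorial z)
  gcongr
  exact mul_le_of_le_one_left (by positivity) (kummerCoeff_le_one ha hab hb n)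

/-- The Chu–Vandermonde identity, in alternating form. -/
theorem sum_antidiagonal_choose_ascPochhammer (n : ℕ) (a b : ℝ) :
    ∑ p ∈ Finset.HasAntidiagonal.antidiagonal n, (n.choose p.1 : ℝ) *
      ((-1) ^ p.1 * Polynomial.eval a (ascPochhammer ℝ p.1) *
        Polynomial.eval (b + p.1) (ascPochhammer ℝ p.2)) =
      Polynomial.eval (b - a) (ascPochhammer ℝ n) := by
  induction n generalizing b with
  | zero => simp
  | succ n ih =>
    rw [Finset.sum_antidiagonal_choose_succ_mul
      (fun i j => (-1) ^ i * Polynomial.eval a (ascPochhammer ℝ i) *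
        Polynomial.eval (b + i) (ascPochhammer ℝ j)), ← Finset.sum_add_distrib,
      ascPochhammer_eval_succ_left, show b - a + 1 = b + 1 - a by ring, ← ih, Finset.mul_sum]
    refine Finset.sum_congr rfl fun p hp => ?_
    rw [Finset.HasAntidiagonal.mem_antidiagonal] at hp
    rw [Nat.choose_symm_of_eq_add hp.symm, ascPochhammer_eval_succ_left, ascPochhammer_succ_eval]
    push_cast
    rw [show b + (p.1 + 1 : ℝ) = b + p.1 + 1 by ring, show b + 1 + (p.1 : ℝ) = b + p.1 + 1 by ring]
    ring

theorem ascPochhammer_eval_add (b : ℝ) (m n : ℕ) :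
    Polynomial.eval b (ascPochhammer ℝ (m + n)) =
      Polynomial.eval b (ascPochhammer ℝ m) * Polynomial.eval (b + m) (ascPochhammer ℝ n) := by
  rw [← ascPochhammer_mul, Polynomial.eval_mul, Polynomial.eval_comp]
  simp

/-- Kummer's transformation. -/
theorem exp_mul_kummerM_neg {a b : ℝ} (ha : 0 ≤ a) (hab : a ≤ b) (hb : 0 < b) (z : ℝ) :
    kummerM a b (-z) * Real.exp z = kummerM (b - a) b z := by
  rw [exp_eq_tsum_div, kummerM_eq_tsum, kummerM_eq_tsum,
    tsum_mul_tsum_eq_tsum_sum_antidiagonal_of_summable_norm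
      (summable_norm_kummerM_term ha hab hb (-z)) (Real.summable_pow_div_factorial z).norm]
  refine tsum_congr fun n => ?_
  rw [kummerCoeff, ← sum_antidiagonal_choose_ascPochhammer, Finset.sum_div, Finset.sum_mul,
    Finset.sum_div]
  refine Finset.sum_congr rfl fun p hp => ?_
  rw [Finset.HasAntidiagonal.mem_antidiagonal] at hp
  subst hp
  have h1 := (ascPochhammer_pos p.1 b hb).ne'
  have h2 := (ascPochhammer_pos p.2 (b + p.1) (by positivity)).ne'
  rw [ascPochhammer_eval_add, kummerCoeff, Nat.choose_symm_add, Nat.add_choose, Nat.cast_div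
    (Nat.factorial_mul_factorial_dvd_factorial_add _ _) (by positivity), neg_pow z, pow_add]
  push_cast
  field_simp

theorem kummerM_neg_pos {a b z : ℝ} (ha : 0 ≤ a) (hab : a ≤ b) (hb : 0 < b) (hz : 0 ≤ z) :
    0 < kummerM a b (-z) := by
  have h := one_le_kummerM (sub_nonneg.2 hab) (sub_le_self b ha) hb hz
  rw [← exp_mul_kummerM_neg ha hab hb] at h
  exact pos_of_mul_pos_left (by linarith) (Real.exp_pos z).le

theorem exists_hasDerivAt_kummerM {a b : ℝ} (ha : 0 ≤ a) (hab : a ≤ b) (hb : 0 < b) (z : ℝ) :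
    ∃ D, HasDerivAt (kummerM a b) D z ∧
      HasSum (fun n : ℕ => n * (kummerCoeff a b n * z ^ n / (n.factorial : ℝ))) (z * D) := by
  set R := |z| + 1
  have hR : 0 < R := by positivity
  have hu : Summable fun n : ℕ => (n : ℝ) * R ^ (n - 1) / (n.factorial : ℝ) := by
    rw [← summable_nat_add_iff 1]
    refine (Real.summable_pow_div_factorial R).congr fun n => ?_
    rw [Nat.factorial_succ]
    push_cast
    field_simp
  have hbound : ∀ n : ℕ, ∀ y ∈ Metric.ball (0 : ℝ) R,
      ‖kummerCoeff a b n * (n * y ^ (n - 1)) / (n.factorial : ℝ)‖ ≤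
        (n : ℝ) * R ^ (n - 1) / (n.factorial : ℝ) := by
    intro n y hy
    rw [mem_ball_zero_iff] at hy
    rw [norm_div, norm_mul, norm_mul, norm_pow, Real.norm_natCast, Real.norm_natCast,
      Real.norm_eq_abs (kummerCoeff a b n), abs_of_nonneg (kummerCoeff_nonneg ha hb n)]
    refine div_le_div_of_nonneg_right ?_ (by positivity)
    exact (mul_le_of_le_one_left (by positivity) (kummerCoeff_le_one ha hab hb n)).trans
      (by gcongr)
  have hz : z ∈ Metric.ball (0 : ℝ) R := by
    rw [mem_ball_zero_iff, Real.norm_eq_abs]; exact lt_add_one _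
  refine ⟨∑' n : ℕ, kummerCoeff a b n * (n * z ^ (n - 1)) / (n.factorial : ℝ), ?_, ?_⟩
  · exact hasDerivAt_tsum_of_isPreconnected hu Metric.isOpen_ball
      (convex_ball (0 : ℝ) R).isPreconnected
      (fun n y _ => ((hasDerivAt_pow n y).const_mul _).div_const _) hbound hz
      (summable_kummerM_term ha hab hb z) hz
  · have hs := (hu.of_norm_bounded fun n => hbound n z hz).hasSum.mul_left z
    refine hs.congr_fun fun n => ?_
    rcases n with _ | n
    · simp
    · rw [pow_succ, Nat.add_sub_cancel]
      ring

theorem hasDerivAt_kummerM {a b : ℝ} (ha : 0 < a) (hab : a + 1 ≤ b) (z : ℝ) :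
    ∃ D, HasDerivAt (kummerM a b) D z ∧ z * D = a * (kummerM (a + 1) b z - kummerM a b z) := by
  have hb : 0 < b := by linarith
  obtain ⟨D, hD, hs⟩ := exists_hasDerivAt_kummerM ha.le (by linarith) hb z
  refine ⟨D, hD, hs.unique ?_⟩
  have h1 := (summable_kummerM_term ha.le (by linarith) hb z).hasSum
  have h2 := (summable_kummerM_term (by linarith : 0 ≤ a + 1) hab hb z).hasSum
  refine ((h2.sub h1).mul_left a).congr_fun fun n => ?_
  linear_combination (-z ^ n / (n.factorial : ℝ)) * mul_kummerCoeff_add_one a b n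

theorem hasDerivAt_kummerM_add_one {a b : ℝ} (ha : 0 < a) (hab : a + 1 ≤ b) (z : ℝ) :
    ∃ D, HasDerivAt (kummerM (a + 1) b) D z ∧
      z * D = (b - a - 1) * kummerM a b z + (a + 1 - b + z) * kummerM (a + 1) b z := by
  have hb : 0 < b := by linarith
  have ha1 : 0 ≤ a + 1 := by linarith
  obtain ⟨D, hD, hs⟩ := exists_hasDerivAt_kummerM ha1 hab hb z
  refine ⟨D, hD, hs.unique ?_⟩
  have h1 := (summable_kummerM_term ha.le (by linarith) hb z).hasSum
  have h2 := (summable_kummerM_term ha1 hab hb z).hasSum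
  have h3 : HasSum (fun n : ℕ =>
      n * (kummerCoeff (a + 1) b (n - 1) * z ^ n / (n.factorial : ℝ)))
      (z * kummerM (a + 1) b z) := by
    rw [← hasSum_nat_add_iff' 1]
    simp only [Finset.range_one, Finset.sum_singleton, Nat.cast_zero, zero_mul, sub_zero]
    refine (h2.mul_left z).congr_fun fun n => ?_
    rw [Nat.factorial_succ, Nat.add_sub_cancel]
    push_cast
    field_simp
    ring
  have h4 := ((h1.mul_left (b - a - 1)).add (h2.mul_left (a + 1 - b))).add h3
  rw [add_mul, ← add_assoc]
  refine h4.congr_fun fun n => ?_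
  rcases n with _ | n
  · simp
    ring
  · have hp : kummerCoeff a b (n + 1) = a * kummerCoeff (a + 1) b n / (b + n) := by
      rw [mul_kummerCoeff_add_one, kummerCoeff_succ]
      ring
    rw [hp, kummerCoeff_succ, Nat.add_sub_cancel]
    push_cast
    field_simp
    ring

/-! ### The solution of the inner equation that is regular at the origin -/

/-- The solution `η ^ κ * M(κ/2, κ + 1/2, -η²/4)` of `y'' + (η/2) y' = κ (κ - 1) / η² * y`. -/
def innerSol (κ η : ℝ) : ℝ :=
  η ^ κ * kummerM (κ / 2) (κ + 1 / 2) (-η ^ 2 / 4)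

/-- The derivative of `innerSol κ`. -/
def innerSolDeriv (κ η : ℝ) : ℝ :=
  κ * η ^ (κ - 1) * kummerM (κ / 2 + 1) (κ + 1 / 2) (-η ^ 2 / 4)

theorem continuous_kummerM {a b : ℝ} (ha : 0 ≤ a) (hab : a ≤ b) (hb : 0 < b) :
    Continuous (kummerM a b) :=
  continuous_iff_continuousAt.2 fun z =>
    (exists_hasDerivAt_kummerM ha hab hb z).choose_spec.1.continuousAt

theorem continuous_innerSol {κ : ℝ} (hκ : 1 ≤ κ) : Continuous (innerSol κ) :=
  (Real.continuous_rpow_const (by linarith)).mul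
    ((continuous_kummerM (by linarith) (by linarith) (by linarith)).comp (by fun_prop))

theorem continuous_innerSolDeriv {κ : ℝ} (hκ : 1 ≤ κ) : Continuous (innerSolDeriv κ) :=
  ((Real.continuous_rpow_const (by linarith)).const_mul κ).mul
    ((continuous_kummerM (by linarith) (by linarith) (by linarith)).comp (by fun_prop))

theorem innerSol_zero {κ : ℝ} (hκ : 1 ≤ κ) : innerSol κ 0 = 0 := by
  simp [innerSol, Real.zero_rpow (by linarith : κ ≠ 0)]

theorem kummerM_inner_pos {κ : ℝ} (hκ : 1 ≤ κ) (η : ℝ) :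
    0 < kummerM (κ / 2) (κ + 1 / 2) (-η ^ 2 / 4) := by
  rw [neg_div]
  exact kummerM_neg_pos (by linarith) (by linarith) (by linarith) (by positivity)

theorem innerSol_pos {κ η : ℝ} (hκ : 1 ≤ κ) (hη : 0 < η) : 0 < innerSol κ η :=
  mul_pos (Real.rpow_pos_of_pos hη κ) (kummerM_inner_pos hκ η)

theorem hasDerivAt_neg_sq_div_four (η : ℝ) :
    HasDerivAt (fun x : ℝ => -x ^ 2 / 4) (-(η / 2)) η := by
  refine (((hasDerivAt_pow 2 η).neg).div_const 4).congr_deriv ?_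
  ring

theorem hasDerivAt_innerSol {κ η : ℝ} (hκ : 1 ≤ κ) (hη : 0 < η) :
    HasDerivAt (innerSol κ) (innerSolDeriv κ η) η := by
  obtain ⟨D, hD, h⟩ := hasDerivAt_kummerM (a := κ / 2) (b := κ + 1 / 2) (by linarith)
    (by linarith) (-η ^ 2 / 4)
  refine ((Real.hasDerivAt_rpow_const (p := κ) (Or.inl hη.ne')).mul
    (hD.comp η (hasDerivAt_neg_sq_div_four η))).congr_deriv ?_
  have hpow : η ^ κ = η ^ (κ - 1) * η := by
    rw [Real.rpow_sub_one hη.ne', div_mul_cancel₀ _ hη.ne']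
  simp only [innerSolDeriv, Function.comp, hpow]
  linear_combination 2 * η ^ (κ - 1) * h

theorem hasDerivAt_innerSolDeriv {κ η : ℝ} (hκ : 1 ≤ κ) (hη : 0 < η) :
    HasDerivAt (innerSolDeriv κ)
      (κ * (κ - 1) / η ^ 2 * innerSol κ η - η / 2 * innerSolDeriv κ η) η := by
  obtain ⟨D, hD, h⟩ := hasDerivAt_kummerM_add_one (a := κ / 2) (b := κ + 1 / 2) (by linarith)
    (by linarith) (-η ^ 2 / 4)
  refine (((Real.hasDerivAt_rpow_const (p := κ - 1) (Or.inl hη.ne')).const_mul κ).mul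
    (hD.comp η (hasDerivAt_neg_sq_div_four η))).congr_deriv ?_
  have hpow : η ^ κ = η ^ (κ - 1 - 1) * η ^ 2 := by
    rw [Real.rpow_sub_one hη.ne', Real.rpow_sub_one hη.ne']
    field_simp
  have hpow' : η ^ (κ - 1) = η ^ (κ - 1 - 1) * η := by
    rw [Real.rpow_sub_one hη.ne' (κ - 1), div_mul_cancel₀ _ hη.ne']
  simp only [innerSolDeriv, innerSol, Function.comp, hpow]
  rw [← mul_assoc _ (η ^ (κ - 1 - 1) * η ^ 2), mul_comm (η ^ (κ - 1 - 1)), ← mul_assoc _ (η ^ 2),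
    div_mul_cancel₀ _ (by positivity), hpow']
  linear_combination 2 * κ * η ^ (κ - 1 - 1) * h

theorem hasDerivAt_exp_sq_div_four (η : ℝ) :
    HasDerivAt (fun x : ℝ => Real.exp (x ^ 2 / 4)) (η / 2 * Real.exp (η ^ 2 / 4)) η := by
  refine (((hasDerivAt_pow 2 η).div_const 4).exp).congr_deriv ?_
  simp
  ring

/-- The weighted Wronskian of two functions satisfying inner equations. -/
theorem hasDerivAt_wronskian {y₁ y₂ y₁' y₂' : ℝ → ℝ} {γ₁ γ₂ y₁'' y₂'' η : ℝ}
    (h₁ : HasDerivAt y₁ (y₁' η) η) (h₁' : HasDerivAt y₁' y₁'' η)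
    (h₂ : HasDerivAt y₂ (y₂' η) η) (h₂' : HasDerivAt y₂' y₂'' η)
    (e₁ : y₁'' + η / 2 * y₁' η - γ₁ / η ^ 2 * y₁ η = 0)
    (e₂ : y₂'' + η / 2 * y₂' η - γ₂ / η ^ 2 * y₂ η = 0) :
    HasDerivAt (fun x => Real.exp (x ^ 2 / 4) * (y₂' x * y₁ x - y₁' x * y₂ x))
      (Real.exp (η ^ 2 / 4) * ((γ₂ - γ₁) / η ^ 2 * (y₁ η * y₂ η))) η := by
  refine ((hasDerivAt_exp_sq_div_four η).mul ((h₂'.mul h₁).sub (h₁'.mul h₂))).congr_deriv ?_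
  simp only [Pi.sub_apply, Pi.mul_apply]
  linear_combination Real.exp (η ^ 2 / 4) * (y₁ η * e₂ - y₂ η * e₁)

/-- The logarithmic derivative of `innerSol κ`. -/
def innerLogDeriv (κ η : ℝ) : ℝ :=
  κ * kummerM (κ / 2 + 1) (κ + 1 / 2) (-η ^ 2 / 4) /
    (η * kummerM (κ / 2) (κ + 1 / 2) (-η ^ 2 / 4))

theorem innerSolDeriv_eq {κ η : ℝ} (hκ : 1 ≤ κ) (hη : 0 < η) :
    innerSolDeriv κ η = innerLogDeriv κ η * innerSol κ η := by
  have := (kummerM_inner_pos hκ η).ne'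
  have hpow : η ^ κ = η ^ (κ - 1) * η := by
    rw [Real.rpow_sub_one hη.ne', div_mul_cancel₀ _ hη.ne']
  simp only [innerSolDeriv, innerLogDeriv, innerSol, hpow]
  generalize kummerM (κ / 2) (κ + 1 / 2) (-η ^ 2 / 4) = m at this ⊢
  field_simp

theorem strictMonoOn_innerLogDeriv {η : ℝ} (hη : 0 < η) :
    StrictMonoOn (fun κ => innerLogDeriv κ η) (Ici 1) := by
  intro κ₁ (h₁ : 1 ≤ κ₁) κ₂ (h₂ : 1 ≤ κ₂) hlt
  have hder : ∀ x > 0, HasDerivAt (fun x => Real.exp (x ^ 2 / 4) *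
      (innerSolDeriv κ₂ x * innerSol κ₁ x - innerSolDeriv κ₁ x * innerSol κ₂ x))
      (Real.exp (x ^ 2 / 4) * ((κ₂ * (κ₂ - 1) - κ₁ * (κ₁ - 1)) / x ^ 2 *
        (innerSol κ₁ x * innerSol κ₂ x))) x := fun x hx =>
    hasDerivAt_wronskian (hasDerivAt_innerSol h₁ hx) (hasDerivAt_innerSolDeriv h₁ hx)
      (hasDerivAt_innerSol h₂ hx) (hasDerivAt_innerSolDeriv h₂ hx) (by ring) (by ring)
  have hmono := strictMonoOn_of_deriv_pos (convex_Icc 0 η)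
    (f := fun x => Real.exp (x ^ 2 / 4) *
      (innerSolDeriv κ₂ x * innerSol κ₁ x - innerSolDeriv κ₁ x * innerSol κ₂ x))
    (Continuous.continuousOn (by
      have := continuous_innerSol h₁
      have := continuous_innerSol h₂
      have := continuous_innerSolDeriv h₁
      have := continuous_innerSolDeriv h₂
      fun_prop)) (fun x hx => by
      rw [interior_Icc] at hx
      rw [(hder x hx.1).deriv]
      have := innerSol_pos h₁ hx.1
      have := innerSol_pos h₂ hx.1
      have := hx.1
      have : 0 < κ₂ * (κ₂ - 1) - κ₁ * (κ₁ - 1) := by nlinarith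
      positivity)
  have h := hmono (left_mem_Icc.2 hη.le) (right_mem_Icc.2 hη.le) hη
  simp only [innerSol_zero h₁, innerSol_zero h₂, mul_zero, sub_self, innerSolDeriv_eq h₁ hη,
    innerSolDeriv_eq h₂ hη] at h
  have h' := pos_of_mul_pos_right h (Real.exp_pos _).le
  rw [show innerLogDeriv κ₂ η * innerSol κ₂ η * innerSol κ₁ η -
    innerLogDeriv κ₁ η * innerSol κ₁ η * innerSol κ₂ η =
    (innerLogDeriv κ₂ η - innerLogDeriv κ₁ η) * (innerSol κ₁ η * innerSol κ₂ η) by ring] at h'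
  exact sub_pos.1 (pos_of_mul_pos_left h'
    (mul_pos (innerSol_pos h₁ hη) (innerSol_pos h₂ hη)).le)

theorem continuousOn_ascPochhammer_eval (n : ℕ) {f : ℝ → ℝ} {s : Set ℝ} (hf : ContinuousOn f s) :
    ContinuousOn (fun κ => Polynomial.eval (f κ) (ascPochhammer ℝ n)) s :=
  (ascPochhammer ℝ n).continuous.comp_continuousOn hf

theorem continuousOn_kummerM_param {a b : ℝ → ℝ} {s : Set ℝ} (ha : ContinuousOn a s)
    (hb : ContinuousOn b s) (h0 : ∀ κ ∈ s, 0 ≤ a κ) (hab : ∀ κ ∈ s, a κ ≤ b κ)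
    (hb0 : ∀ κ ∈ s, 0 < b κ) (z : ℝ) : ContinuousOn (fun κ => kummerM (a κ) (b κ) z) s := by
  refine continuousOn_tsum (fun n => ?_) (Real.summable_pow_div_factorial |z|)
    fun n κ hκ => norm_kummerM_term_le (h0 κ hκ) (hab κ hκ) (hb0 κ hκ) z n
  exact (((continuousOn_ascPochhammer_eval n ha).div (continuousOn_ascPochhammer_eval n hb)
    fun κ hκ => (ascPochhammer_pos n _ (hb0 κ hκ)).ne').mul_const _).div_const _

theorem continuousOn_innerLogDeriv {η : ℝ} (hη : 0 < η) :
    ContinuousOn (fun κ => innerLogDeriv κ η) (Ici 1) := by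
  refine ContinuousOn.div (continuousOn_id.mul (continuousOn_kummerM_param ?_ ?_ ?_ ?_ ?_ _))
    (continuousOn_const.mul (continuousOn_kummerM_param ?_ ?_ ?_ ?_ ?_ _))
    fun κ hκ => (mul_pos hη (kummerM_inner_pos hκ η)).ne'
  any_goals fun_prop
  all_goals
    intro κ (hκ : 1 ≤ κ)
    linarith

theorem le_innerLogDeriv {κ η : ℝ} (hκ : 1 ≤ κ) (hη : 0 < η) :
    κ * (Real.exp (-η ^ 2 / 4) / η) ≤ innerLogDeriv κ η := by
  have hz : 0 ≤ η ^ 2 / 4 := by positivity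
  have hM := kummerM_inner_pos hκ η
  have h1 := one_le_kummerM (a := κ + 1 / 2 - (κ / 2 + 1)) (b := κ + 1 / 2) (by linarith)
    (by linarith) (by linarith) hz
  have h2 := kummerM_le_exp (a := κ + 1 / 2 - κ / 2) (b := κ + 1 / 2) (by linarith)
    (by linarith) (by linarith) hz
  rw [← exp_mul_kummerM_neg (by linarith) (by linarith) (by linarith), ← neg_div] at h1 h2
  have h3 := (mul_le_iff_le_one_left (Real.exp_pos _)).1 h2
  have h4 : Real.exp (-η ^ 2 / 4) ≤ kummerM (κ / 2 + 1) (κ + 1 / 2) (-η ^ 2 / 4) := by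
    rw [neg_div, Real.exp_neg, ← neg_div]
    exact (inv_le_iff_one_le_mul₀ (Real.exp_pos _)).2 h1
  rw [innerLogDeriv, mul_div_assoc]
  gcongr
  · exact (Real.exp_pos _).le.trans h4
  · exact mul_le_of_le_one_right hη.le h3

/-! ### The complementary error function -/

theorem integrable_exp_neg_sq : Integrable fun s : ℝ => Real.exp (-s ^ 2) := by
  simpa using integrable_exp_neg_mul_sq one_pos

theorem erfc_eq (x : ℝ) :
    erfc x = 2 / Real.sqrt Real.pi * ((∫ s in Ioi (0 : ℝ), Real.exp (-s ^ 2)) -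
      ∫ s in (0 : ℝ)..x, Real.exp (-s ^ 2)) := by
  rw [erfc, ← intervalIntegral.integral_interval_add_Ioi
    (integrable_exp_neg_sq.integrableOn (s := Ioi 0))
    (integrable_exp_neg_sq.integrableOn (s := Ioi x)), add_sub_cancel_left]

theorem erfc_pos (x : ℝ) : 0 < erfc x := by
  refine mul_pos (by positivity) ?_
  rw [setIntegral_pos_iff_support_of_nonneg_ae (ae_of_all _ fun s => (Real.exp_pos _).le)
    integrable_exp_neg_sq.integrableOn]
  have : Function.support (fun s : ℝ => Real.exp (-s ^ 2)) = univ :=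
    eq_univ_of_forall fun s => (Real.exp_pos _).ne'
  simp [this]

theorem hasDerivAt_erfc (x : ℝ) :
    HasDerivAt erfc (-(2 / Real.sqrt Real.pi * Real.exp (-x ^ 2))) x := by
  have hc : Continuous fun s : ℝ => Real.exp (-s ^ 2) := by fun_prop
  rw [funext erfc_eq]
  refine (((hc.integral_hasStrictDerivAt 0 x).hasDerivAt.const_sub _).const_mul _).congr_deriv ?_
  ring

theorem tendsto_erfc : Tendsto erfc atTop (nhds 0) := by
  rw [funext erfc_eq]
  have h := ((intervalIntegral_tendsto_integral_Ioi 0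
    (integrable_exp_neg_sq.integrableOn (s := Ioi 0)) tendsto_id).const_sub
      (∫ s in Ioi (0 : ℝ), Real.exp (-s ^ 2))).const_mul (2 / Real.sqrt Real.pi)
  simpa using h

theorem hasDerivAt_erfc_div_two (η : ℝ) :
    HasDerivAt (fun x => erfc (x / 2))
      (-(Real.exp (-η ^ 2 / 4) / Real.sqrt Real.pi)) η := by
  refine ((hasDerivAt_erfc (η / 2)).comp η ((hasDerivAt_id η).div_const 2)).congr_deriv ?_
  rw [show -(η / 2) ^ 2 = -η ^ 2 / 4 by ring]
  ring

theorem tendsto_erfc_div_two : Tendsto (fun x => erfc (x / 2)) atTop (nhds 0) :=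
  tendsto_erfc.comp (tendsto_id.atTop_div_const two_pos)

/-! ### The matching equation -/

theorem one_le_kappaOf {γ : ℝ} (hγ : 0 ≤ γ) : 1 ≤ kappaOf γ := by
  have : 1 ≤ Real.sqrt (4 * γ + 1) := Real.one_le_sqrt.2 (by linarith)
  rw [kappaOf]
  linarith

theorem kappaOf_mul_sub_one {γ : ℝ} (hγ : 0 ≤ γ) : kappaOf γ * (kappaOf γ - 1) = γ := by
  have := Real.sq_sqrt (by linarith : 0 ≤ 4 * γ + 1)
  rw [kappaOf]
  linear_combination this / 4

theorem kappaOf_of_one_le {κ : ℝ} (hκ : 1 ≤ κ) : kappaOf (κ * (κ - 1)) = κ := by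
  rw [kappaOf, show 4 * (κ * (κ - 1)) + 1 = (2 * κ - 1) ^ 2 by ring,
    Real.sqrt_sq (by linarith)]
  ring

theorem kappaOf_zero : kappaOf 0 = 1 := by
  norm_num [kappaOf]

theorem kappaOf_lt_kappaOf {γ₁ γ₂ : ℝ} (h₁ : 0 ≤ γ₁) (h : γ₁ < γ₂) : kappaOf γ₁ < kappaOf γ₂ := by
  have := Real.sqrt_lt_sqrt (by linarith : 0 ≤ 4 * γ₁ + 1) (by linarith : _ < 4 * γ₂ + 1)
  rw [kappaOf, kappaOf]
  linarith

/-- Minus the logarithmic derivative of `η ↦ erfc (η / 2)`. -/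
def outerLogDeriv (η : ℝ) : ℝ :=
  Real.exp (-η ^ 2 / 4) / (Real.sqrt Real.pi * erfc (η / 2))

theorem outerLogDeriv_pos (η : ℝ) : 0 < outerLogDeriv η :=
  div_pos (Real.exp_pos _) (mul_pos (by positivity) (erfc_pos _))

theorem innerLogDeriv_pos {κ η : ℝ} (hκ : 1 ≤ κ) (hη : 0 < η) : 0 < innerLogDeriv κ η :=
  lt_of_lt_of_le (by positivity) (le_innerLogDeriv hκ hη)

theorem ustarGamma_eq (α β γ : ℝ) :
    ustarGamma α β γ = α * β / 2 * (innerLogDeriv (kappaOf γ) α + outerLogDeriv α)⁻¹ := rfl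

theorem ustarGamma_mul {α γ : ℝ} (hα : 0 < α) (hγ : 0 ≤ γ) (β : ℝ) :
    ustarGamma α β γ * (innerLogDeriv (kappaOf γ) α + outerLogDeriv α) = α * β / 2 := by
  have := innerLogDeriv_pos (one_le_kappaOf hγ) hα
  have := outerLogDeriv_pos α
  rw [ustarGamma_eq, inv_mul_cancel_right₀ (by positivity)]

theorem strictAntiOn_ustarGamma {α β : ℝ} (hα : 0 < α) (hβ : 0 < β) :
    StrictAntiOn (ustarGamma α β) (Ici 0) := by
  intro γ₁ (h₁ : 0 ≤ γ₁) γ₂ (h₂ : 0 ≤ γ₂) hlt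
  have hmono := strictMonoOn_innerLogDeriv hα (one_le_kappaOf h₁) (one_le_kappaOf h₂)
    (kappaOf_lt_kappaOf h₁ hlt)
  have := innerLogDeriv_pos (one_le_kappaOf h₁) hα
  have := outerLogDeriv_pos α
  simp only [ustarGamma_eq] at hmono ⊢
  gcongr

theorem exists_ustarGamma_eq {α β ustar : ℝ} (hα : 0 < α) (hβ : 0 < β) (hu : 0 < ustar)
    (h : ustar < ustarGamma α β 0) : ∃ γ, 0 < γ ∧ ustarGamma α β γ = ustar := by
  set c := α * β / 2 / ustar - outerLogDeriv α with hc
  have hpos := add_pos (innerLogDeriv_pos le_rfl hα) (outerLogDeriv_pos α)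
  have h1 : innerLogDeriv 1 α < c := by
    rw [ustarGamma_eq, kappaOf_zero, ← div_eq_mul_inv, lt_div_iff₀ hpos, mul_comm,
      ← lt_div_iff₀ hu] at h
    linarith
  set K := max 1 (c / (Real.exp (-α ^ 2 / 4) / α))
  have hK : 1 ≤ K := le_max_left _ _
  have h2 : c ≤ innerLogDeriv K α :=
    ((div_le_iff₀ (by positivity)).1 (le_max_right _ _)).trans (le_innerLogDeriv hK hα)
  obtain ⟨κ, hκ, hκc⟩ := intermediate_value_Icc hK
    ((continuousOn_innerLogDeriv hα).mono Icc_subset_Ici_self) ⟨h1.le, h2⟩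
  have hκ1 : 1 < κ := hκ.1.lt_of_ne (by rintro rfl; exact h1.ne hκc)
  refine ⟨κ * (κ - 1), mul_pos (by linarith) (by linarith), ?_⟩
  simp only at hκc
  rw [ustarGamma_eq, kappaOf_of_one_le hκ.1, hκc, hc, sub_add_cancel]
  field_simp

/-! ### The boundary value problem -/

theorem Phi_of_lt {α γ η : ℝ} (h : η < α) (β : ℝ) :
    Phi α β γ η = ustarGamma α β γ / innerSol (kappaOf γ) α * innerSol (kappaOf γ) η := by
  rw [Phi, if_pos h, innerSol, innerSol]
  ring

theorem Phi_of_ge {α γ η : ℝ} (h : α ≤ η) (β : ℝ) :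
    Phi α β γ η = ustarGamma α β γ / erfc (α / 2) * erfc (η / 2) := by
  rw [Phi, if_neg h.not_gt]
  ring

theorem Phi_of_le {α γ η : ℝ} (hα : 0 < α) (hγ : 0 ≤ γ) (h : η ≤ α) (β : ℝ) :
    Phi α β γ η = ustarGamma α β γ / innerSol (kappaOf γ) α * innerSol (kappaOf γ) η := by
  rcases h.lt_or_eq with h | rfl
  · exact Phi_of_lt h β
  · rw [Phi_of_ge le_rfl, div_mul_cancel₀ _ (erfc_pos _).ne',
      div_mul_cancel₀ _ (innerSol_pos (one_le_kappaOf hγ) hα).ne']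

theorem Phi_self (α β γ : ℝ) : Phi α β γ α = ustarGamma α β γ := by
  rw [Phi_of_ge le_rfl, div_mul_cancel₀ _ (erfc_pos _).ne']

theorem hasDerivWithinAt_Phi_Ici (α β γ : ℝ) :
    HasDerivWithinAt (Phi α β γ) (-(ustarGamma α β γ * outerLogDeriv α)) (Ici α) α := by
  refine (((hasDerivAt_erfc_div_two α).const_mul
    (ustarGamma α β γ / erfc (α / 2))).hasDerivWithinAt.congr
      (fun η hη => Phi_of_ge hη β) (Phi_of_ge le_rfl β)).congr_deriv ?_
  rw [outerLogDeriv]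
  field_simp

theorem hasDerivWithinAt_Phi_Iic {α γ : ℝ} (hα : 0 < α) (hγ : 0 ≤ γ) (β : ℝ) :
    HasDerivWithinAt (Phi α β γ) (ustarGamma α β γ * innerLogDeriv (kappaOf γ) α) (Iic α) α := by
  refine (((hasDerivAt_innerSol (one_le_kappaOf hγ) hα).const_mul
    (ustarGamma α β γ / innerSol (kappaOf γ) α)).hasDerivWithinAt.congr
      (fun η hη => Phi_of_le hα hγ hη β) (Phi_of_le hα hγ le_rfl β)).congr_deriv ?_
  have := (innerSol_pos (one_le_kappaOf hγ) hα).ne'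
  rw [innerSolDeriv_eq (one_le_kappaOf hγ) hα]
  field_simp

theorem continuous_erfc_div_two : Continuous fun x => erfc (x / 2) :=
  continuous_iff_continuousAt.2 fun η => (hasDerivAt_erfc_div_two η).continuousAt

theorem continuous_Phi {α γ : ℝ} (hα : 0 < α) (hγ : 0 ≤ γ) (β : ℝ) :
    Continuous (Phi α β γ) := by
  have h : Phi α β γ = fun η => if η ≤ α then
      ustarGamma α β γ / innerSol (kappaOf γ) α * innerSol (kappaOf γ) η
      else ustarGamma α β γ / erfc (α / 2) * erfc (η / 2) := by
    funext η
    split_ifs with h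
    · exact Phi_of_le hα hγ h β
    · exact Phi_of_ge (not_le.1 h).le β
  rw [h]
  refine Continuous.if_le ((continuous_innerSol (one_le_kappaOf hγ)).const_mul _)
    (continuous_erfc_div_two.const_mul _) continuous_id continuous_const ?_
  rintro η rfl
  rw [← Phi_of_le hα hγ le_rfl, Phi_of_ge le_rfl]

theorem hasDerivAt_innerSol_zero {κ : ℝ} (hκ : 1 < κ) : HasDerivAt (innerSol κ) 0 0 := by
  have h1 := Real.hasDerivAt_rpow_const (x := 0) (p := κ) (Or.inr hκ.le)
  obtain ⟨D, hD, -⟩ := exists_hasDerivAt_kummerM (a := κ / 2) (b := κ + 1 / 2) (by linarith)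
    (by linarith) (by linarith) (-(0 : ℝ) ^ 2 / 4)
  refine (h1.mul (hD.comp 0 (hasDerivAt_neg_sq_div_four 0))).congr_deriv ?_
  simp [Real.zero_rpow (by linarith : κ ≠ 0), Real.zero_rpow (by linarith : κ - 1 ≠ 0)]

theorem isProfileSolution_Phi {α γ : ℝ} (hα : 0 < α) (hγ : 0 < γ) (β : ℝ) :
    IsProfileSolution α β (ustarGamma α β γ) γ (Phi α β γ) := by
  set κ := kappaOf γ
  have hκ : 1 ≤ κ := one_le_kappaOf hγ.le
  have hκγ : κ * (κ - 1) = γ := kappaOf_mul_sub_one hγ.le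
  have hκ1 : 1 < κ := by
    simpa [kappaOf_zero] using kappaOf_lt_kappaOf le_rfl hγ
  set A := ustarGamma α β γ / innerSol κ α
  set B := ustarGamma α β γ / erfc (α / 2)
  set E : ℝ → ℝ := fun η => -(Real.exp (-η ^ 2 / 4) / Real.sqrt Real.pi)
  have hE : ∀ η, HasDerivAt E (-(η / 2) * E η) η := fun η => by
    refine (((hasDerivAt_neg_sq_div_four η).exp.div_const (Real.sqrt Real.pi)).neg).congr_deriv ?_
    simp only [E]
    ring
  have hlt : ∀ {η}, η < α → Phi α β γ =ᶠ[nhds η] fun x => A * innerSol κ x := fun h =>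
    (eventually_lt_nhds h).mono fun x hx => Phi_of_lt hx β
  have hgt : ∀ {η}, α < η → Phi α β γ =ᶠ[nhds η] fun x => B * erfc (x / 2) := fun h =>
    (eventually_gt_nhds h).mono fun x hx => Phi_of_ge hx.le β
  refine ⟨(continuous_Phi hα hγ.le β).continuousOn, Phi_self α β γ, ?_,
    fun η => if η < α then A * innerSolDeriv κ η else B * E η,
    fun η => if η < α then A * (γ / η ^ 2 * innerSol κ η - η / 2 * innerSolDeriv κ η)
      else B * (-(η / 2) * E η), ?_, ?_, ?_, ?_, ?_, ?_, ?_, ?_, ?_, ?_⟩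
  · have h := tendsto_erfc_div_two.const_mul B
    rw [mul_zero] at h
    exact h.congr' ((eventually_ge_atTop α).mono fun η hη => (Phi_of_ge hη β).symm)
  · intro η hη
    beta_reduce
    rw [if_pos hη.2]
    exact ((hasDerivAt_innerSol hκ hη.1).const_mul A).congr_of_eventuallyEq (hlt hη.2)
  · intro η hη
    beta_reduce
    rw [if_pos hη.2, ← hκγ]
    exact ((hasDerivAt_innerSolDeriv hκ hη.1).const_mul A).congr_of_eventuallyEq
      ((eventually_lt_nhds hη.2).mono fun x hx => if_pos hx)
  · intro η (hη : α < η)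
    beta_reduce
    rw [if_neg hη.not_gt]
    exact ((hasDerivAt_erfc_div_two η).const_mul B).congr_of_eventuallyEq (hgt hη)
  · intro η (hη : α < η)
    beta_reduce
    rw [if_neg hη.not_gt]
    exact ((hE η).const_mul B).congr_of_eventuallyEq
      ((eventually_gt_nhds hη).mono fun x hx => if_neg (not_lt.2 (le_of_lt hx)))
  · refine ContinuousOn.congr (f := fun η => A * (γ / η ^ 2 * innerSol κ η -
      η / 2 * innerSolDeriv κ η)) ?_ fun η hη => if_pos hη.2
    have h1 := continuous_innerSol hκ
    have h2 := continuous_innerSolDeriv hκ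
    have h3 : ContinuousOn (fun η : ℝ => γ / η ^ 2) (Ioo 0 α) :=
      continuousOn_const.div (by fun_prop) fun η hη => (pow_pos hη.1 2).ne'
    fun_prop
  · refine ContinuousOn.congr (f := fun η => B * (-(η / 2) * E η)) ?_
      fun η (hη : α < η) => if_neg hη.not_gt
    fun_prop
  · intro η hη
    simp only [if_pos hη.2, Phi_of_lt hη.2]
    ring
  · intro η (hη : α < η)
    simp only [if_neg hη.not_gt]
    ring
  · refine ⟨_, _, hasDerivWithinAt_Phi_Iic hα hγ.le β, hasDerivWithinAt_Phi_Ici α β γ, ?_⟩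
    rw [← ustarGamma_mul hα hγ.le β]
    ring
  · have h := ((hasDerivAt_innerSol_zero hκ1).const_mul A).congr_of_eventuallyEq (hlt hα)
    rw [mul_zero] at h
    exact h.hasDerivWithinAt

/-- Decaying solutions of the outer equation are multiples of `η ↦ erfc (η / 2)`. -/
theorem outer_unique {α : ℝ} {f f' f'' : ℝ → ℝ} (hcont : ContinuousWithinAt f (Ici α) α)
    (hlim : Tendsto f atTop (nhds 0)) (h1 : ∀ η ∈ Ioi α, HasDerivAt f (f' η) η)
    (h2 : ∀ η ∈ Ioi α, HasDerivAt f' (f'' η) η)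
    (hode : ∀ η ∈ Ioi α, f'' η + η / 2 * f' η = 0) :
    ∀ η ∈ Ici α, f η = f α / erfc (α / 2) * erfc (η / 2) := by
  have hd : ∀ η ∈ Ioi α, HasDerivAt (fun x => Real.exp (x ^ 2 / 4) * f' x) 0 η := fun η hη => by
    refine ((hasDerivAt_exp_sq_div_four η).mul (h2 η hη)).congr_deriv ?_
    linear_combination Real.exp (η ^ 2 / 4) * hode η hη
  obtain ⟨c, hc⟩ := isOpen_Ioi.exists_is_const_of_deriv_eq_zero isPreconnected_Ioi
    (fun η hη => (hd η hη).differentiableAt.differentiableWithinAt) fun η hη => (hd η hη).deriv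
  have hd' : ∀ η ∈ Ioi α, HasDerivAt
      (fun x => f x + c * Real.sqrt Real.pi * erfc (x / 2)) 0 η := fun η hη => by
    refine ((h1 η hη).add ((hasDerivAt_erfc_div_two η).const_mul _)).congr_deriv ?_
    have hpi : Real.sqrt Real.pi ≠ 0 := by positivity
    rw [← hc η hη, neg_div, Real.exp_neg]
    field_simp
    ring
  obtain ⟨A, hA⟩ := isOpen_Ioi.exists_is_const_of_deriv_eq_zero isPreconnected_Ioi
    (fun η hη => (hd' η hη).differentiableAt.differentiableWithinAt) fun η hη => (hd' η hη).deriv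
  have hA0 : A = 0 := by
    have h := hlim.add (tendsto_erfc_div_two.const_mul (c * Real.sqrt Real.pi))
    rw [mul_zero, add_zero] at h
    exact tendsto_nhds_unique (tendsto_const_nhds.congr'
      ((eventually_gt_atTop α).mono fun η hη => (hA η hη).symm)) h
  have hf : ∀ η ∈ Ioi α, f η = -(c * Real.sqrt Real.pi) * erfc (η / 2) := fun η hη => by
    linear_combination hA η hη + hA0
  have hfα : f α = -(c * Real.sqrt Real.pi) * erfc (α / 2) := by
    refine tendsto_nhds_unique (hcont.mono_left (nhdsWithin_mono α Ioi_subset_Ici_self)) ?_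
    exact ((continuous_erfc_div_two.const_mul _).continuousWithinAt (s := Ioi α)).tendsto.congr'
      (eventually_mem_nhdsWithin.mono fun η hη => (hf η hη).symm)
  intro η hη
  rw [hfα, mul_div_cancel_right₀ _ (erfc_pos _).ne']
  rcases (mem_Ici.1 hη).eq_or_lt with rfl | h
  · exact hfα
  · exact hf η h

/-- A solution of the inner equation with the same logarithmic derivative as `innerSol κ` at `α`
is a multiple of `innerSol κ`. -/
theorem inner_unique {α κ d : ℝ} (hα : 0 < α) (hκ : 1 ≤ κ) {f f' f'' : ℝ → ℝ}
    (h1 : ∀ η ∈ Ioo 0 α, HasDerivAt f (f' η) η) (h2 : ∀ η ∈ Ioo 0 α, HasDerivAt f' (f'' η) η)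
    (hode : ∀ η ∈ Ioo 0 α, f'' η + η / 2 * f' η - κ * (κ - 1) / η ^ 2 * f η = 0)
    (hd : HasDerivWithinAt f d (Iic α) α) (hdα : d = innerLogDeriv κ α * f α) :
    ∀ η ∈ Ioo 0 α, f η = f α / innerSol κ α * innerSol κ η := by
  have hy : ∀ η ∈ Ioo 0 α, innerSol κ η ≠ 0 := fun η hη => (innerSol_pos hκ hη.1).ne'
  have hyα := (innerSol_pos hκ hα).ne'
  have hw : ∀ η ∈ Ioo 0 α, HasDerivAt (fun x => Real.exp (x ^ 2 / 4) *
      (f' x * innerSol κ x - innerSolDeriv κ x * f x)) 0 η := fun η hη => by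
    refine (hasDerivAt_wronskian (hasDerivAt_innerSol hκ hη.1) (hasDerivAt_innerSolDeriv hκ hη.1)
      (h1 η hη) (h2 η hη) (γ₁ := κ * (κ - 1)) (by ring) (hode η hη)).congr_deriv ?_
    simp
  obtain ⟨c, hc⟩ := isOpen_Ioo.exists_is_const_of_deriv_eq_zero isPreconnected_Ioo
    (fun η hη => (hw η hη).differentiableAt.differentiableWithinAt) fun η hη => (hw η hη).deriv
  have hq : ∀ η ∈ Ioo 0 α, HasDerivAt (fun x => f x / innerSol κ x)
      (c * (Real.exp (η ^ 2 / 4) * innerSol κ η ^ 2)⁻¹) η := fun η hη => by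
    refine ((h1 η hη).div (hasDerivAt_innerSol hκ hη.1) (hy η hη)).congr_deriv ?_
    rw [← hc η hη]
    have := hy η hη
    field_simp
  have hqα : HasDerivWithinAt (fun x => f x / innerSol κ x) 0 (Iic α) α := by
    refine (hd.div (hasDerivAt_innerSol hκ hα).hasDerivWithinAt hyα).congr_deriv ?_
    rw [hdα, innerSolDeriv_eq hκ hα]
    field_simp
    ring
  have hmem : Ioo 0 α ∈ nhdsWithin α (Iio α) := Ioo_mem_nhdsLT hα
  have hqα' : HasDerivWithinAt (fun x => f x / innerSol κ x)
      (c * (Real.exp (α ^ 2 / 4) * innerSol κ α ^ 2)⁻¹) (Iic α) α := by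
    refine hasDerivWithinAt_Iic_of_tendsto_deriv (s := Ioo 0 α)
      (fun η hη => (hq η hη).differentiableAt.differentiableWithinAt)
      (hqα.continuousWithinAt.mono fun η hη => hη.2.le) hmem ?_
    have hcont : ContinuousAt (fun η => c * (Real.exp (η ^ 2 / 4) * innerSol κ η ^ 2)⁻¹) α := by
      have := (continuous_innerSol hκ).continuousAt (x := α)
      refine continuousAt_const.mul (ContinuousAt.inv₀ (by fun_prop) ?_)
      exact mul_ne_zero (Real.exp_pos _).ne' (pow_ne_zero 2 hyα)
    exact (hcont.continuousWithinAt (s := Iio α)).tendsto.congr'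
      (mem_of_superset hmem fun η hη => (hq η hη).deriv.symm)
  have hc0 : c = 0 := by
    have h := (uniqueDiffOn_Iic α α self_mem_Iic).eq_deriv _ hqα' hqα
    rcases mul_eq_zero.1 h with h | h
    · exact h
    · exact absurd h (inv_ne_zero (mul_ne_zero (Real.exp_pos _).ne' (pow_ne_zero 2 hyα)))
  obtain ⟨A, hA⟩ := isOpen_Ioo.exists_is_const_of_deriv_eq_zero isPreconnected_Ioo
    (fun η hη => (hq η hη).differentiableAt.differentiableWithinAt)
    fun η hη => by rw [(hq η hη).deriv, hc0, zero_mul]; rfl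
  have hAα : f α / innerSol κ α = A := by
    refine tendsto_nhds_unique (hqα.continuousWithinAt.mono_left
      (nhdsWithin_mono α Iio_subset_Iic_self)) ?_
    exact tendsto_const_nhds.congr' (mem_of_superset hmem fun η hη => (hA η hη).symm)
  intro η hη
  rw [hAα, ← hA η hη, div_mul_cancel₀ _ (hy η hη)]

theorem IsProfileSolution.eq_Phi {α β γ : ℝ} (hα : 0 < α) (hγ : 0 < γ) {Φ : ℝ → ℝ}
    (h : IsProfileSolution α β (ustarGamma α β γ) γ Φ) {η : ℝ} (hη : 0 ≤ η) :
    Φ η = Phi α β γ η := by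
  obtain ⟨hcont, hval, hlim, Φ', Φ'', h1, h2, h3, h4, -, -, h5, h6, ⟨dL, dR, hL, hR, hjump⟩, -⟩ := h
  have hκ := one_le_kappaOf hγ.le
  have hout : ∀ x ∈ Ici α, Φ x = Phi α β γ x := fun x hx => by
    rw [outer_unique ((hcont α hα.le).mono (Ici_subset_Ici.2 hα.le)) hlim h3 h4 h6 x hx,
      Phi_of_ge hx, hval]
  have hdR : dR = -(ustarGamma α β γ * outerLogDeriv α) :=
    (uniqueDiffOn_Ici α α self_mem_Ici).eq_deriv _ hR
      ((hasDerivWithinAt_Phi_Ici α β γ).congr hout (hout α self_mem_Ici))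
  have hdL : dL = innerLogDeriv (kappaOf γ) α * Φ α := by
    rw [hval]
    linear_combination hdR - hjump - ustarGamma_mul hα hγ.le β
  have hin : ∀ x ∈ Ioo 0 α, Φ x = Phi α β γ x := fun x hx => by
    rw [inner_unique hα hκ h1 h2 (by rwa [kappaOf_mul_sub_one hγ.le]) hL hdL x hx,
      Phi_of_lt hx.2, hval]
  rcases le_or_gt α η with h | h
  · exact hout η h
  rcases hη.eq_or_lt with rfl | h0
  · refine tendsto_nhds_unique ((hcont 0 self_mem_Ici).mono_left
      (nhdsWithin_mono 0 Ioi_subset_Ici_self)) ?_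
    exact ((continuous_Phi hα hγ.le β).continuousWithinAt (s := Ioi 0)).tendsto.congr'
      (mem_of_superset (Ioo_mem_nhdsGT hα) fun x hx => (hin x hx).symm)
  · exact hin η ⟨h0, h⟩

/-- the matching condition `u*_γ = u*` has a unique solution `γ > 0`
iff `u* < u*₀`; in that case `Φ_γ` is the unique solution of the stationary boundary
value problem. -/
theorem selfsimilar_profile_existence_uniqueness (α β ustar : ℝ)
    (hα : 0 < α) (hβ : 0 < β) (hu : 0 < ustar) :
    ((∃! γ : ℝ, 0 < γ ∧ ustarGamma α β γ = ustar) ↔ ustar < ustarGamma α β 0) ∧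
    (ustar < ustarGamma α β 0 →
      ∀ γ : ℝ, 0 < γ → ustarGamma α β γ = ustar →
        IsProfileSolution α β ustar γ (Phi α β γ) ∧
        ∀ Φ : ℝ → ℝ, IsProfileSolution α β ustar γ Φ →
          ∀ η : ℝ, 0 ≤ η → Φ η = Phi α β γ η) := by
  refine ⟨⟨?_, fun h => ?_⟩, ?_⟩
  · rintro ⟨γ, ⟨hγ, rfl⟩, -⟩
    exact strictAntiOn_ustarGamma hα hβ self_mem_Ici hγ.le hγ
  · obtain ⟨γ, hγ, hγu⟩ := exists_ustarGamma_eq hα hβ hu h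
    exact ⟨γ, ⟨hγ, hγu⟩, fun γ' h' => (strictAntiOn_ustarGamma hα hβ).injOn h'.1.le hγ.le
      (h'.2.trans hγu.symm)⟩
  · rintro - γ hγ rfl
    exact ⟨isProfileSolution_Phi hα hγ β, fun Φ hΦ η hη => hΦ.eq_Phi hα hγ hη⟩

end
end
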